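/- Let r ∈ (1,∞), s ∈ (0,∞), and let ‖·‖_X be a ball quasi-Banach function space on ℝ^n such that X^{1/s} is a ball Banach function space, and suppose there exists q₀ ∈ [1,∞) such that X^{1/(sq₀)} is a Banach function space and the Hardy–Littlewood maximal operator M is bounded on the associate space (X^{1/(sq₀)})', i.e. there is C' with ‖M(f)‖_{(X^{1/(sq₀)})'} ≤ C'‖f‖_{(X^{1/(sq₀)})'} for all measurable f. Then there exists a constant C > 0 such that for every sequence (f_j) of measurable functions on ℝ^n and every α > 0: α ‖χ_{{x ∈ ℝ^n : (Σ_j (M(f_j))(x)^r)^{1/r} > α}}‖_{X^{1/s}} ≤ C ‖(Σ_j |f_j|^r)^{1/r}‖_{X^{1/s}}. -/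

import Mathlib

noncomputable section

open MeasureTheory Real Set
open scoped ENNReal NNReal

abbrev En (n : ℕ) : Type := EuclideanSpace ℝ (Fin n)

/-- The (centered) Hardy–Littlewood maximal operator. -/
def hlMax (n : ℕ) (f : En n → ℝ≥0∞) (x : En n) : ℝ≥0∞ :=
  ⨆ (r : ℝ) (_ : 0 < r), (volume (Metric.ball x r))⁻¹ * ∫⁻ y in Metric.ball x r, f y

/-- The powered Hardy–Littlewood maximal operator `M^{(θ)}`. -/
def hlMaxPow (n : ℕ) (θ : ℝ) (f : En n → ℝ≥0∞) (x : En n) : ℝ≥0∞ :=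
  (hlMax n (fun y => f y ^ θ) x) ^ (1/θ)

/-- A ball quasi-Banach function space on `ℝ^n`, encoded by its quasinorm acting on
(the absolute values of) measurable functions, i.e. on `ℝ≥0∞`-valued functions. -/
structure BallQBF (n : ℕ) where
  Q : (En n → ℝ≥0∞) → ℝ≥0∞
  eq_zero_iff : ∀ f, Q f = 0 ↔ f =ᵐ[volume] 0
  smul_eq : ∀ (c : ℝ≥0) (f), Q (fun x => (c : ℝ≥0∞) * f x) = (c : ℝ≥0∞) * Q f
  exists_quasi : ∃ K : ℝ≥0, 1 ≤ K ∧ ∀ f g, Q (f + g) ≤ (K : ℝ≥0∞) * (Q f + Q g)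
  mono : ∀ f g, (∀ᵐ x ∂volume, f x ≤ g x) → Q f ≤ Q g
  sup_of_monotone : ∀ (f : ℕ → En n → ℝ≥0∞), Monotone f →
    Q (fun x => ⨆ m, f m x) = ⨆ m, Q (f m)
  ball_lt_top : ∀ (x : En n) (r : ℝ), 0 < r →
    Q ((Metric.ball x r).indicator 1) < ⊤

/-- The weak quasinorm `‖f‖_{WX}` associated with a quasinorm `Q`. -/
def weakQ (n : ℕ) (Q : (En n → ℝ≥0∞) → ℝ≥0∞) (f : En n → ℝ≥0∞) : ℝ≥0∞ :=
  ⨆ (α : ℝ≥0) (_ : 0 < α), (α : ℝ≥0∞) * Q ({x | (α : ℝ≥0∞) < f x}.indicator 1)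

/-- The `p`-convexification quasinorm `‖f‖_{X^p} = ‖|f|^p‖_X^{1/p}`. -/
def convQ (n : ℕ) (Q : (En n → ℝ≥0∞) → ℝ≥0∞) (p : ℝ) (f : En n → ℝ≥0∞) : ℝ≥0∞ :=
  (Q fun x => f x ^ p) ^ (1/p)

/-- The associate (Köthe dual) norm `‖g‖_{X'}`. -/
def assocQ (n : ℕ) (Q : (En n → ℝ≥0∞) → ℝ≥0∞) (g : En n → ℝ≥0∞) : ℝ≥0∞ :=
  ⨆ (f : En n → ℝ≥0∞) (_ : Q f ≤ 1), ∫⁻ x, f x * g x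

/-- `X` has an absolutely continuous quasinorm. -/
def AbsolutelyContinuous (n : ℕ) (Q : (En n → ℝ≥0∞) → ℝ≥0∞) : Prop :=
  ∀ (f : En n → ℝ≥0∞), Q f < ⊤ → ∀ (E : ℕ → Set (En n)),
    (∀ j, E (j+1) ⊆ E j) → (⋂ j, E j) = ∅ →
    Filter.Tendsto (fun j => Q ((E j).indicator f)) Filter.atTop (nhds 0)


namespace FS

open Metric Filter Topology

/-- Uncentered maximal operator with respect to `μ`. -/
def uMax {n : ℕ} (μ : Measure (En n)) (f : En n → ℝ≥0∞) (x : En n) : ℝ≥0∞ :=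
  ⨆ (c : En n) (ρ : ℝ) (_ : x ∈ ball c ρ), (μ (ball c ρ))⁻¹ * ∫⁻ y in ball c ρ, f y ∂μ

/-- Globally doubling measures. -/
structure Dbl {n : ℕ} (μ : Measure (En n)) (D : ℝ≥0) : Prop where
  pos : ∀ c ρ, 0 < ρ → 0 < μ (ball c ρ)
  fin : ∀ c ρ, μ (ball c ρ) < ⊤
  dbl : ∀ c ρ, 0 < ρ → μ (ball c (2 * ρ)) ≤ D * μ (ball c ρ)

variable {n : ℕ} {μ : Measure (En n)} {D : ℝ≥0}

lemma Dbl.locFin (h : Dbl μ D) : IsLocallyFiniteMeasure μ :=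
  ⟨fun x => ⟨ball x 1, ball_mem_nhds x one_pos, h.fin x 1⟩⟩

lemma Dbl.dbl4 (h : Dbl μ D) (c : En n) (ρ : ℝ) (hρ : 0 < ρ) :
    μ (ball c (4 * ρ)) ≤ (D : ℝ≥0∞) ^ 2 * μ (ball c ρ) := by
  have h1 := h.dbl c (2 * ρ) (by positivity)
  have h2 := h.dbl c ρ hρ
  have : (4 * ρ) = 2 * (2 * ρ) := by ring
  rw [this, pow_two, mul_assoc]
  exact h1.trans (by gcongr)

lemma Dbl.dbl8 (h : Dbl μ D) (c : En n) (ρ : ℝ) (hρ : 0 < ρ) :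
    μ (ball c (8 * ρ)) ≤ (D : ℝ≥0∞) ^ 3 * μ (ball c ρ) := by
  have h1 := h.dbl c (4 * ρ) (by positivity)
  have h2 := h.dbl4 c ρ hρ
  have : (8 * ρ) = 2 * (4 * ρ) := by ring
  rw [this, pow_succ', mul_assoc]
  exact h1.trans (by gcongr)

lemma le_uMax (f : En n → ℝ≥0∞) {x c : En n} {ρ : ℝ} (hx : x ∈ ball c ρ) :
    (μ (ball c ρ))⁻¹ * ∫⁻ y in ball c ρ, f y ∂μ ≤ uMax μ f x := by
  unfold uMax
  exact le_iSup_of_le c (le_iSup_of_le ρ (le_iSup_of_le hx le_rfl))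

lemma uMax_le {f : En n → ℝ≥0∞} {x : En n} {b : ℝ≥0∞}
    (h : ∀ c ρ, x ∈ ball c ρ → (μ (ball c ρ))⁻¹ * ∫⁻ y in ball c ρ, f y ∂μ ≤ b) :
    uMax μ f x ≤ b := by
  unfold uMax
  exact iSup_le fun c => iSup_le fun ρ => iSup_le fun hx => h c ρ hx

lemma lt_uMax_iff {f : En n → ℝ≥0∞} {x : En n} {b : ℝ≥0∞} :
    b < uMax μ f x ↔ ∃ c ρ, x ∈ ball c ρ ∧
      b < (μ (ball c ρ))⁻¹ * ∫⁻ y in ball c ρ, f y ∂μ := by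
  unfold uMax
  simp only [lt_iSup_iff, exists_prop]

lemma isOpen_lt_uMax (f : En n → ℝ≥0∞) (b : ℝ≥0∞) : IsOpen {x | b < uMax μ f x} := by
  have : {x | b < uMax μ f x} = ⋃ (c : En n) (ρ : ℝ)
      (_ : b < (μ (ball c ρ))⁻¹ * ∫⁻ y in ball c ρ, f y ∂μ), ball c ρ := by
    ext x
    simp only [mem_ofPred_eq, lt_uMax_iff, mem_iUnion, exists_prop]
    constructor
    · rintro ⟨c, ρ, h1, h2⟩; exact ⟨c, ρ, h2, h1⟩
    · rintro ⟨c, ρ, h1, h2⟩; exact ⟨c, ρ, h2, h1⟩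
  rw [this]
  exact isOpen_iUnion fun c => isOpen_iUnion fun ρ => isOpen_iUnion fun _ => isOpen_ball

lemma measurable_uMax (f : En n → ℝ≥0∞) : Measurable (uMax μ f) :=
  measurable_of_Ioi fun b => (isOpen_lt_uMax f b).measurableSet

lemma uMax_mono {f g : En n → ℝ≥0∞} (h : ∀ x, f x ≤ g x) (x : En n) :
    uMax μ f x ≤ uMax μ g x := by
  refine uMax_le fun c ρ hx => le_trans ?_ (le_uMax g hx)
  gcongr with y
  exact h y

lemma uMax_tsum {f : ℕ → En n → ℝ≥0∞} (hf : ∀ j, Measurable (f j)) (x : En n) :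
    uMax μ (fun y => ∑' j, f j y) x ≤ ∑' j, uMax μ (f j) x := by
  refine uMax_le fun c ρ hx => ?_
  rw [lintegral_tsum fun j => (hf j).aemeasurable, ← ENNReal.tsum_mul_left]
  exact ENNReal.tsum_le_tsum fun j => le_uMax (f j) hx

lemma uMax_const_mul (c : ℝ≥0) (f : En n → ℝ≥0∞) (x : En n) :
    uMax μ (fun y => c * f y) x = c * uMax μ f x := by
  unfold uMax
  simp only [ENNReal.mul_iSup]
  refine iSup_congr fun a => iSup_congr fun ρ => iSup_congr fun hx => ?_
  rw [lintegral_const_mul' _ _ ENNReal.coe_ne_top]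
  ring

lemma uMax_add {f g : En n → ℝ≥0∞} (hf : Measurable f) (x : En n) :
    uMax μ (fun y => f y + g y) x ≤ uMax μ f x + uMax μ g x := by
  refine uMax_le fun c ρ hx => ?_
  rw [lintegral_add_left hf, mul_add]
  exact add_le_add (le_uMax f hx) (le_uMax g hx)

/-- Averages of a bounded function. -/
lemma uMax_le_of_le {f : En n → ℝ≥0∞} {b : ℝ≥0∞} (h : ∀ x, f x ≤ b) (x : En n) :
    uMax μ f x ≤ b := by
  refine uMax_le fun c ρ hx => ?_
  calc (μ (ball c ρ))⁻¹ * ∫⁻ y in ball c ρ, f y ∂μ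
      ≤ (μ (ball c ρ))⁻¹ * ∫⁻ y in ball c ρ, b ∂μ := by gcongr with y; exact h y
    _ = b * ((μ (ball c ρ))⁻¹ * μ (ball c ρ)) := by
        rw [setLIntegral_const]; ring
    _ ≤ b * 1 := by gcongr; exact ENNReal.inv_mul_le_one _
    _ = b := mul_one b

lemma uMax_pos (hD : Dbl μ D) {f : En n → ℝ≥0∞} (hf : Measurable f)
    (h : ¬ (f =ᵐ[μ] 0)) (x : En n) : 0 < uMax μ f x := by
  by_contra hcon
  have h0 : uMax μ f x = 0 := by simpa using hcon
  apply h
  have h1 : ∀ m : ℕ, ∫⁻ y in ball x (m + 1), f y ∂μ = 0 := by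
    intro m
    have hx : x ∈ ball x ((m : ℝ) + 1) := mem_ball_self (by positivity)
    have := le_uMax (μ := μ) f hx
    rw [h0] at this
    have := le_antisymm this bot_le
    rcases mul_eq_zero.1 this with h2 | h2
    · exact absurd h2 (ENNReal.inv_ne_zero.2 (hD.fin _ _).ne)
    · exact h2
  have h2 : ∀ m : ℕ, ∀ᵐ y ∂(μ.restrict (ball x ((m : ℝ) + 1))), f y = 0 := fun m =>
    (lintegral_eq_zero_iff hf).1 (h1 m)
  have h3 : (⋃ m : ℕ, ball x ((m : ℝ) + 1)) = univ := by
    refine eq_univ_of_forall fun y => mem_iUnion.2 ?_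
    obtain ⟨m, hm⟩ := exists_nat_gt (dist y x)
    exact ⟨m, mem_ball.2 (by linarith)⟩
  have h4 := (ae_restrict_iUnion_iff (μ := μ) (fun m : ℕ => ball x ((m : ℝ) + 1))
    (fun y => f y = 0)).2 h2
  rw [h3, Measure.restrict_univ] at h4
  exact h4

lemma weak_aux (hD : Dbl μ D) (f : En n → ℝ≥0∞) (t : ℝ≥0∞) (R : ℝ) :
    t * μ (⋃ a ∈ {a : En n × ℝ | 0 < a.2 ∧ a.2 ≤ R ∧
        t * μ (ball a.1 a.2) ≤ ∫⁻ y in ball a.1 a.2, f y ∂μ}, ball a.1 a.2)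
      ≤ (D : ℝ≥0∞) ^ 3 * ∫⁻ y, f y ∂μ := by
  set T := {a : En n × ℝ | 0 < a.2 ∧ a.2 ≤ R ∧
        t * μ (ball a.1 a.2) ≤ ∫⁻ y in ball a.1 a.2, f y ∂μ} with hT
  obtain ⟨u, huT, hdisj, hcov⟩ := Vitali.exists_disjoint_subfamily_covering_enlargement_closedBall
    T (fun a => a.1) (fun a => a.2) R (fun a ha => ha.2.1) 5 (by norm_num)
  have hdisj' : u.PairwiseDisjoint fun a => ball a.1 a.2 := by
    intro a ha b hb hab
    exact (hdisj ha hb hab).mono ball_subset_closedBall ball_subset_closedBall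
  have hcount : u.Countable := hdisj'.countable_of_isOpen (fun _ _ => isOpen_ball)
    (fun a ha => nonempty_ball.2 (huT ha).1)
  have hsub : (⋃ a ∈ T, ball a.1 a.2) ⊆ ⋃ b ∈ u, ball b.1 (8 * b.2) := by
    refine iUnion₂_subset fun a ha => ?_
    obtain ⟨b, hb, hab⟩ := hcov a ha
    refine (ball_subset_closedBall.trans hab).trans ?_
    refine subset_trans ?_ (subset_biUnion_of_mem hb)
    exact closedBall_subset_ball (by have := (huT hb).1; linarith)
  have := hcount.to_subtype
  calc t * μ (⋃ a ∈ T, ball a.1 a.2) ≤ t * μ (⋃ b ∈ u, ball b.1 (8 * b.2)) := by gcongr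
    _ ≤ t * ∑' b : u, μ (ball b.1.1 (8 * b.1.2)) := by
        gcongr; exact measure_biUnion_le _ hcount _
    _ = ∑' b : u, t * μ (ball b.1.1 (8 * b.1.2)) := ENNReal.tsum_mul_left.symm
    _ ≤ ∑' b : u, (D : ℝ≥0∞) ^ 3 * ∫⁻ y in ball b.1.1 b.1.2, f y ∂μ := by
        refine ENNReal.tsum_le_tsum fun b => ?_
        have hb := huT b.2
        calc t * μ (ball b.1.1 (8 * b.1.2)) ≤ t * ((D : ℝ≥0∞) ^ 3 * μ (ball b.1.1 b.1.2)) := by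
              gcongr; exact hD.dbl8 _ _ hb.1
          _ = (D : ℝ≥0∞) ^ 3 * (t * μ (ball b.1.1 b.1.2)) := by ring
          _ ≤ _ := by gcongr; exact hb.2.2
    _ = (D : ℝ≥0∞) ^ 3 * ∑' b : u, ∫⁻ y in ball b.1.1 b.1.2, f y ∂μ := ENNReal.tsum_mul_left
    _ = (D : ℝ≥0∞) ^ 3 * ∫⁻ y in ⋃ b ∈ u, ball b.1 b.2, f y ∂μ := by
        rw [lintegral_biUnion hcount (fun _ _ => measurableSet_ball) hdisj']
    _ ≤ _ := by gcongr; exact Measure.restrict_le_self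

lemma weak_type (hD : Dbl μ D) (f : En n → ℝ≥0∞) (t : ℝ≥0∞) :
    t * μ {x | t < uMax μ f x} ≤ (D : ℝ≥0∞) ^ 3 * ∫⁻ y, f y ∂μ := by
  let S : ℕ → Set (En n) := fun m => ⋃ a ∈ {a : En n × ℝ | 0 < a.2 ∧ a.2 ≤ m ∧
        t * μ (ball a.1 a.2) ≤ ∫⁻ y in ball a.1 a.2, f y ∂μ}, ball a.1 a.2
  have hmono : Monotone S := by
    intro m m' hm
    refine biUnion_subset_biUnion_left ?_
    rintro a ⟨h1, h2, h3⟩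
    exact ⟨h1, h2.trans (by exact_mod_cast hm), h3⟩
  have hsub : {x | t < uMax μ f x} ⊆ ⋃ m, S m := by
    intro x hx
    obtain ⟨c, ρ, hxc, hlt⟩ := lt_uMax_iff.1 hx
    have hρ : 0 < ρ := pos_of_mem_ball hxc
    obtain ⟨m, hm⟩ := exists_nat_ge ρ
    refine mem_iUnion.2 ⟨m, ?_⟩
    refine mem_biUnion (x := (c, ρ)) ⟨hρ, hm, ?_⟩ hxc
    have h0 := (hD.pos c ρ hρ).ne'
    have h1 := (hD.fin c ρ).ne
    calc t * μ (ball c ρ)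
        ≤ ((μ (ball c ρ))⁻¹ * ∫⁻ y in ball c ρ, f y ∂μ) * μ (ball c ρ) := by gcongr
      _ = ((μ (ball c ρ))⁻¹ * μ (ball c ρ)) * ∫⁻ y in ball c ρ, f y ∂μ := by ring
      _ = _ := by rw [ENNReal.inv_mul_cancel h0 h1, one_mul]
  calc t * μ {x | t < uMax μ f x} ≤ t * μ (⋃ m, S m) := by gcongr
    _ = ⨆ m, t * μ (S m) := by rw [hmono.measure_iUnion, ENNReal.mul_iSup]
    _ ≤ _ := iSup_le fun m => weak_aux hD f t m

end FS

namespace FS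

open Metric Filter Topology

variable {n : ℕ} {μ : Measure (En n)} {D : ℝ≥0}

lemma layer (p : ℝ) (hp : 0 < p) (a : ℝ≥0∞) :
    ENNReal.ofReal p * ∫⁻ t in Ioi (0 : ℝ),
      {s : ℝ | ENNReal.ofReal s < a}.indicator (fun s => ENNReal.ofReal (s ^ (p - 1))) t = a ^ p := by
  have key : ∀ b : ℝ, 0 ≤ b → ENNReal.ofReal p * ∫⁻ t in Ioi (0 : ℝ),
      {s : ℝ | ENNReal.ofReal s < ENNReal.ofReal b}.indicator
        (fun s => ENNReal.ofReal (s ^ (p - 1))) t = ENNReal.ofReal b ^ p := by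
    intro b hb
    have h := lintegral_rpow_eq_lintegral_meas_lt_mul (Measure.dirac ()) (f := fun _ => b)
      (Eventually.of_forall fun _ => hb) aemeasurable_const hp
    rw [lintegral_dirac] at h
    rw [ENNReal.ofReal_rpow_of_nonneg hb hp.le, h]
    congr 1
    refine setLIntegral_congr_fun measurableSet_Ioi fun t ht => ?_
    simp only [mem_Ioi] at ht
    by_cases htb : t < b
    · have : ENNReal.ofReal t < ENNReal.ofReal b := (ENNReal.ofReal_lt_ofReal_iff (ht.trans htb)).2 htb
      simp [indicator, htb, this]
    · have : ¬ ENNReal.ofReal t < ENNReal.ofReal b := by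
        rw [not_lt] at htb ⊢
        exact ENNReal.ofReal_le_ofReal htb
      simp [indicator, htb, this]
  rcases eq_or_ne a ⊤ with rfl | ha
  · rw [ENNReal.top_rpow_of_pos hp]
    refine ENNReal.eq_top_of_forall_nnreal_le fun r => ?_
    have h1 := key ((r : ℝ) ^ (1 / p)) (by positivity)
    have h2 : ENNReal.ofReal ((r : ℝ) ^ (1 / p)) ^ p = r := by
      rw [ENNReal.ofReal_rpow_of_nonneg (by positivity) hp.le, ← Real.rpow_mul (by positivity)]
      simp [hp.ne']
    rw [h2] at h1
    rw [← h1]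
    gcongr with t
    exact le_top
  · have := key a.toReal ENNReal.toReal_nonneg
    rwa [ENNReal.ofReal_toReal ha] at this

lemma weak_trunc (hD : Dbl μ D) {f : En n → ℝ≥0∞} (hf : Measurable f) (t : ℝ≥0) :
    t * μ {x | t < uMax μ f x} ≤ 2 * (D : ℝ≥0∞) ^ 3 *
      ∫⁻ y, {y | (t : ℝ≥0∞) < 2 * f y}.indicator f y ∂μ := by
  set g : En n → ℝ≥0∞ := {y | (t : ℝ≥0∞) < 2 * f y}.indicator f with hg
  have hgm : Measurable g := hf.indicator (measurableSet_lt measurable_const (hf.const_mul 2))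
  have hle : ∀ y, f y ≤ g y + (t / 2 : ℝ≥0) := by
    intro y
    by_cases hy : (t : ℝ≥0∞) < 2 * f y
    · simp [hg, hy]
    · simp only [hg, indicator, mem_ofPred_eq, hy, if_false, zero_add]
      rw [not_lt] at hy
      rw [ENNReal.coe_div two_ne_zero, ENNReal.le_div_iff_mul_le (by simp) (by simp), mul_comm]
      exact hy
  have hsub : {x | (t : ℝ≥0∞) < uMax μ f x} ⊆ {x | ((t / 2 : ℝ≥0) : ℝ≥0∞) < uMax μ g x} := by
    intro x hx
    simp only [mem_ofPred_eq] at hx ⊢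
    have h1 : uMax μ f x ≤ uMax μ g x + (t / 2 : ℝ≥0) :=
      (uMax_mono hle x).trans ((uMax_add hgm x).trans
        (by gcongr; exact uMax_le_of_le (fun _ => le_rfl) x))
    by_contra hcon
    rw [not_lt] at hcon
    have : (t : ℝ≥0∞) < (t / 2 : ℝ≥0) + (t / 2 : ℝ≥0) := hx.trans_le (h1.trans (by gcongr))
    rw [← ENNReal.coe_add, add_halves] at this
    exact lt_irrefl _ this
  have hw := weak_type hD g ((t / 2 : ℝ≥0) : ℝ≥0∞)
  calc (t : ℝ≥0∞) * μ {x | t < uMax μ f x}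
      ≤ t * μ {x | ((t / 2 : ℝ≥0) : ℝ≥0∞) < uMax μ g x} := by gcongr
    _ = 2 * ((t / 2 : ℝ≥0) * μ {x | ((t / 2 : ℝ≥0) : ℝ≥0∞) < uMax μ g x}) := by
        rw [← mul_assoc]
        congr 1
        have : t = 2 * (t / 2) := by rw [mul_div_cancel₀]; simp
        conv_lhs => rw [this]
        push_cast; rfl
    _ ≤ 2 * ((D : ℝ≥0∞) ^ 3 * ∫⁻ y, g y ∂μ) := by gcongr
    _ = _ := by ring

lemma strong_type (hD : Dbl μ D) (p : ℝ) (hp : 1 < p) {f : En n → ℝ≥0∞} (hf : Measurable f) :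
    ∫⁻ x, uMax μ f x ^ p ∂μ ≤
      ((2 * D ^ 3 * Real.toNNReal p * (Real.toNNReal (p - 1))⁻¹ * 2 ^ (p - 1) : ℝ≥0) : ℝ≥0∞)
        * ∫⁻ x, f x ^ p ∂μ := by
  have := hD.locFin
  have hp0 : 0 < p := by linarith
  have hp1 : 0 < p - 1 := by linarith
  have hmeas : ∀ (q : ℝ) (u : En n → ℝ≥0∞), Measurable u → Measurable
      (fun z : En n × ℝ => {s : ℝ | ENNReal.ofReal s < u z.1}.indicator
        (fun s => ENNReal.ofReal (s ^ q)) z.2) := by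
    intro q u hu
    have : (fun z : En n × ℝ => {s : ℝ | ENNReal.ofReal s < u z.1}.indicator
        (fun s => ENNReal.ofReal (s ^ q)) z.2) =
        {z : En n × ℝ | ENNReal.ofReal z.2 < u z.1}.indicator
          (fun z => ENNReal.ofReal (z.2 ^ q)) := by
      ext z; simp [indicator]
    rw [this]
    refine Measurable.indicator ?_ (measurableSet_lt
      (ENNReal.measurable_ofReal.comp measurable_snd) (hu.comp measurable_fst))
    exact ENNReal.measurable_ofReal.comp (measurable_snd.pow_const q)
  calc ∫⁻ x, uMax μ f x ^ p ∂μ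
      = ENNReal.ofReal p * ∫⁻ x, (∫⁻ t in Ioi (0 : ℝ),
          {s : ℝ | ENNReal.ofReal s < uMax μ f x}.indicator
            (fun s => ENNReal.ofReal (s ^ (p - 1))) t) ∂μ := by
        rw [← lintegral_const_mul' _ _ ENNReal.ofReal_ne_top]
        exact lintegral_congr fun x => (layer p hp0 _).symm
    _ = ENNReal.ofReal p * ∫⁻ t in Ioi (0 : ℝ), (∫⁻ x,
          {s : ℝ | ENNReal.ofReal s < uMax μ f x}.indicator
            (fun s => ENNReal.ofReal (s ^ (p - 1))) t ∂μ) := by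
        rw [lintegral_lintegral_swap]
        exact (hmeas (p - 1) _ (measurable_uMax f)).aemeasurable
    _ ≤ ENNReal.ofReal p * ∫⁻ t in Ioi (0 : ℝ), (2 * (D : ℝ≥0∞) ^ 3 * ∫⁻ x, f x *
          {s : ℝ | ENNReal.ofReal s < 2 * f x}.indicator
            (fun s => ENNReal.ofReal (s ^ (p - 1 - 1))) t ∂μ) := by
        gcongr 1
        refine setLIntegral_mono' measurableSet_Ioi fun t ht => ?_
        simp only [mem_Ioi] at ht
        have h1 : ∫⁻ x, {s : ℝ | ENNReal.ofReal s < uMax μ f x}.indicator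
            (fun s => ENNReal.ofReal (s ^ (p - 1))) t ∂μ =
            ENNReal.ofReal (t ^ (p - 1)) * μ {x | ENNReal.ofReal t < uMax μ f x} := by
          rw [← lintegral_indicator_const (isOpen_lt_uMax f _).measurableSet]
          refine lintegral_congr fun x => ?_
          simp [indicator]
        have h2 : ∫⁻ x, f x * {s : ℝ | ENNReal.ofReal s < 2 * f x}.indicator
            (fun s => ENNReal.ofReal (s ^ (p - 1 - 1))) t ∂μ =
            ENNReal.ofReal (t ^ (p - 1 - 1)) *
              ∫⁻ y, {y | (ENNReal.ofReal t : ℝ≥0∞) < 2 * f y}.indicator f y ∂μ := by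
          rw [← lintegral_const_mul' _ _ ENNReal.ofReal_ne_top]
          refine lintegral_congr fun x => ?_
          by_cases hx : ENNReal.ofReal t < 2 * f x
          · simp [indicator, mul_comm]
          · simp [indicator, hx]
        have h3 := weak_trunc hD hf t.toNNReal
        change ENNReal.ofReal t * μ {x | ENNReal.ofReal t < uMax μ f x} ≤ _ *
          ∫⁻ y, {y | (ENNReal.ofReal t : ℝ≥0∞) < 2 * f y}.indicator f y ∂μ at h3
        rw [h1, h2]
        have h4 : t ^ (p - 1) = t ^ (p - 1 - 1) * t := by
          rw [← Real.rpow_add_one ht.ne']; congr 1; ring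
        rw [h4, ENNReal.ofReal_mul (by positivity), mul_assoc]
        calc _ ≤ ENNReal.ofReal (t ^ (p - 1 - 1)) * (2 * (D : ℝ≥0∞) ^ 3 * 
               ∫⁻ y, {y | (ENNReal.ofReal t : ℝ≥0∞) < 2 * f y}.indicator f y ∂μ) := by gcongr
          _ = _ := by ring
    _ = ENNReal.ofReal p * (2 * (D : ℝ≥0∞) ^ 3 * ∫⁻ x, (∫⁻ t in Ioi (0 : ℝ),  f x *
          {s : ℝ | ENNReal.ofReal s < 2 * f x}.indicator
            (fun s => ENNReal.ofReal (s ^ (p - 1 - 1))) t) ∂μ) := by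
        rw [lintegral_const_mul' _ _ (by finiteness), lintegral_lintegral_swap]
        refine Measurable.aemeasurable ?_
        exact (hf.comp measurable_snd).mul ((hmeas (p - 1 - 1) _ (hf.const_mul 2)).comp
          measurable_swap)
    _ = ENNReal.ofReal p * (2 * (D : ℝ≥0∞) ^ 3 * ∫⁻ x, f x *
          ((ENNReal.ofReal (p - 1))⁻¹ * (2 * f x) ^ (p - 1)) ∂μ) := by
        congr 2
        refine lintegral_congr fun x => ?_
        rw [lintegral_const_mul, ← layer (p - 1) hp1 (2 * f x), ← mul_assoc (_⁻¹),
          ENNReal.inv_mul_cancel (by simpa using hp1) (by simp), one_mul]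
        exact (hmeas (p - 1 - 1) _ (hf.const_mul 2)).comp measurable_prodMk_left
    _ = _ := by
        have : ∀ x, f x * ((ENNReal.ofReal (p - 1))⁻¹ * (2 * f x) ^ (p - 1)) =
            ((ENNReal.ofReal (p - 1))⁻¹ * 2 ^ (p - 1)) * f x ^ p := by
          intro x
          rw [ENNReal.mul_rpow_of_nonneg _ _ hp1.le]
          have : f x ^ p = f x * f x ^ (p - 1) := by
            conv_lhs => rw [show p = 1 + (p - 1) by ring]
            rw [ENNReal.rpow_add_of_nonneg _ _ zero_le_one hp1.le, ENNReal.rpow_one]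
          rw [this]; ring
        simp_rw [this]
        rw [lintegral_const_mul _ (hf.pow_const p)]
        have e1 : ((2 : ℝ≥0∞) ^ (p - 1)) = ((2 ^ (p - 1) : ℝ≥0) : ℝ≥0∞) := by
          rw [ENNReal.coe_rpow_of_nonneg _ hp1.le]; norm_num
        have e2 : (ENNReal.ofReal (p - 1))⁻¹ = (((p - 1).toNNReal⁻¹ : ℝ≥0) : ℝ≥0∞) := by
          rw [ENNReal.coe_inv (by simpa using hp)]; rfl
        rw [e1, e2]
        push_cast
        change ((p.toNNReal : ℝ≥0) : ℝ≥0∞) * _ = _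
        ring

end FS

namespace FS

open Metric Filter Topology

variable {n : ℕ} {μ : Measure (En n)} {D : ℝ≥0}

/-- The `ℓ^r` norm of a sequence. -/
def lr (r : ℝ) (a : ℕ → ℝ≥0∞) : ℝ≥0∞ := (∑' j, a j ^ r) ^ (1 / r)

lemma lr_mono {r : ℝ} (hr : 0 < r) {a b : ℕ → ℝ≥0∞} (h : ∀ j, a j ≤ b j) : lr r a ≤ lr r b := by
  unfold lr
  gcongr with j
  exact h j

lemma lr_const_mul {r : ℝ} (hr : 0 < r) (c : ℝ≥0∞) (a : ℕ → ℝ≥0∞) :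
    lr r (fun j => c * a j) = c * lr r a := by
  unfold lr
  simp_rw [ENNReal.mul_rpow_of_nonneg _ _ hr.le]
  rw [ENNReal.tsum_mul_left, ENNReal.mul_rpow_of_nonneg _ _ (by positivity), ← ENNReal.rpow_mul]
  rw [mul_one_div_cancel hr.ne', ENNReal.rpow_one]

lemma lr_rpow {r : ℝ} (hr : 0 < r) (a : ℕ → ℝ≥0∞) : lr r a ^ r = ∑' j, a j ^ r := by
  unfold lr
  rw [← ENNReal.rpow_mul, one_div_mul_cancel hr.ne', ENNReal.rpow_one]

lemma lr_le_iff {r : ℝ} (hr : 0 < r) (a : ℕ → ℝ≥0∞) (b : ℝ≥0∞) :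
    lr r a ≤ b ↔ ∑' j, a j ^ r ≤ b ^ r := by
  rw [← lr_rpow hr, ENNReal.rpow_le_rpow_iff hr]

lemma le_lr {r : ℝ} (hr : 0 < r) (a : ℕ → ℝ≥0∞) (j : ℕ) : a j ≤ lr r a := by
  rw [← ENNReal.rpow_le_rpow_iff hr, lr_rpow hr]
  exact ENNReal.le_tsum j

lemma measurable_lr {α : Type*} [MeasurableSpace α] (r : ℝ) {f : ℕ → α → ℝ≥0∞}
    (hf : ∀ j, Measurable (f j)) : Measurable (fun x => lr r (fun j => f j x)) := by
  unfold lr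
  exact (Measurable.tsum fun j => (hf j).pow_const r).pow_const _

lemma minkowski {α : Type*} [MeasurableSpace α] (m : Measure α) {r : ℝ} (hr : 1 < r)
    {f : ℕ → α → ℝ≥0∞} (hf : ∀ j, Measurable (f j)) :
    lr r (fun j => ∫⁻ x, f j x ∂m) ≤ ∫⁻ x, lr r (fun j => f j x) ∂m := by
  have hr0 : 0 < r := by linarith
  set I := ∫⁻ x, lr r (fun j => f j x) ∂m with hI
  rw [lr_le_iff hr0]
  rcases eq_or_ne I ⊤ with hT | hT
  · rw [hT, ENNReal.top_rpow_of_pos hr0]; exact le_top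
  have haI : ∀ j, ∫⁻ x, f j x ∂m ≤ I := fun j => lintegral_mono fun x => le_lr hr0 _ j
  set a : ℕ → ℝ≥0∞ := fun j => ∫⁻ x, f j x ∂m with ha
  rw [ENNReal.tsum_eq_iSup_sum]
  refine iSup_le fun s => ?_
  set S := ∑ j ∈ s, a j ^ r with hS
  have hSfin : S ≠ ⊤ := by
    refine (ENNReal.sum_lt_top.2 fun j _ => ?_).ne
    exact ENNReal.rpow_lt_top_of_nonneg hr0.le ((haI j).trans_lt hT.lt_top).ne
  have hpq := Real.HolderConjugate.conjExponent hr
  set q := r.conjExponent with hq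
  have hq0' : 0 < 1 / q := one_div_pos.2 hpq.symm.pos
  rcases eq_or_ne S 0 with h0 | h0
  · rw [h0]; exact bot_le
  have h1 : S ≤ S ^ (1 / q) * I := by
    calc S = ∑ j ∈ s, ∫⁻ x, a j ^ (r - 1) * f j x ∂m := by
          refine Finset.sum_congr rfl fun j _ => ?_
          rw [lintegral_const_mul _ (hf j)]
          conv_lhs => rw [show r = (r - 1) + 1 by ring]
          rw [ENNReal.rpow_add_of_nonneg _ _ (by linarith) zero_le_one, ENNReal.rpow_one]
      _ = ∫⁻ x, ∑ j ∈ s, a j ^ (r - 1) * f j x ∂m := by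
          rw [lintegral_finsetSum _ fun j _ => (hf j).const_mul _]
      _ ≤ ∫⁻ x, S ^ (1 / q) * lr r (fun j => f j x) ∂m := by
          refine lintegral_mono fun x => ?_
          refine (ENNReal.inner_le_Lp_mul_Lq s _ _ hpq.symm).trans ?_
          refine mul_le_mul' (ENNReal.rpow_le_rpow ?_ hq0'.le) ?_
          · rw [hS]
            refine Finset.sum_le_sum fun j _ => le_of_eq ?_
            rw [← ENNReal.rpow_mul]
            congr 1
            rw [hq, Real.conjExponent]
            field_simp [show r - 1 ≠ 0 by linarith]
          · unfold lr
            gcongr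
            exact ENNReal.sum_le_tsum s
      _ = S ^ (1 / q) * I := by rw [lintegral_const_mul _ (measurable_lr r hf)]
  have hq0 : 0 < q := hpq.symm.pos
  have h2 : S = S ^ (1 / q) * S ^ (1 / r) := by
    rw [← ENNReal.rpow_add _ _ h0 hSfin]
    have := hpq.symm.inv_add_inv_eq_one
    rw [one_div, one_div, this, ENNReal.rpow_one]
  have h3 : S ^ (1 / r) ≤ I := by
    rw [h2] at h1
    have hx0 : S ^ (1 / q) ≠ 0 := by
      simp [ENNReal.rpow_eq_zero_iff, h0, hSfin]
    have hxt : S ^ (1 / q) ≠ ⊤ := (ENNReal.rpow_lt_top_of_nonneg (by positivity) hSfin).ne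
    rw [← h2] at h1
    nth_rewrite 1 [h2] at h1
    exact (ENNReal.mul_le_mul_iff_right hx0 hxt).1 h1
  calc S = (S ^ (1 / r)) ^ r := by
        rw [← ENNReal.rpow_mul, one_div_mul_cancel hr0.ne', ENNReal.rpow_one]
    _ ≤ I ^ r := by gcongr

end FS

namespace FS

open Metric Filter Topology

variable {n : ℕ} {μ : Measure (En n)} {D : ℝ≥0}

/-- one tenth of the distance to the complement -/
def dd (Ω : Set (En n)) (y : En n) : ℝ := infDist y Ωᶜ / 10

/-- local averages at the scale of the distance to the complement -/
def lavg (μ : Measure (En n)) (Ω : Set (En n)) (f : En n → ℝ≥0∞) (y : En n) : ℝ≥0∞ :=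
  (μ (ball y (dd Ω y)))⁻¹ * ∫⁻ z in ball y (dd Ω y), f z ∂μ

/-- The good part. -/
def good (μ : Measure (En n)) (Ω : Set (En n)) (f : En n → ℝ≥0∞) (y : En n) : ℝ≥0∞ :=
  Ω.indicator (lavg μ Ω f) y + Ωᶜ.indicator f y

/-- Transition kernel. -/
def ker (μ : Measure (En n)) (Ω : Set (En n)) (y z : En n) : ℝ≥0∞ :=
  (μ (ball y (dd Ω y)))⁻¹ * (ball y (dd Ω y)).indicator 1 z

lemma dd_pos {Ω : Set (En n)} (hΩ : IsOpen Ω) (hne : (Ωᶜ).Nonempty) {y : En n} (hy : y ∈ Ω) :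
    0 < dd Ω y := by
  have := (hΩ.isClosed_compl.notMem_iff_infDist_pos hne (x := y)).1 (by simpa using hy)
  unfold dd; linarith

lemma dd_lip (Ω : Set (En n)) (y z : En n) : dd Ω y ≤ dd Ω z + dist y z / 10 := by
  unfold dd
  have := infDist_le_infDist_add_dist (s := Ωᶜ) (x := y) (y := z)
  linarith

lemma mem_of_dd_pos {Ω : Set (En n)} {y : En n} (h : 0 < dd Ω y) : y ∈ Ω := by
  by_contra hy
  have : infDist y Ωᶜ = 0 := infDist_zero_of_mem hy
  unfold dd at h; rw [this] at h; simp at h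

lemma dd_nonneg (Ω : Set (En n)) (y : En n) : 0 ≤ dd Ω y := by
  unfold dd; have := infDist_nonneg (x := y) (s := Ωᶜ); linarith

lemma continuous_dd (Ω : Set (En n)) : Continuous (dd Ω) :=
  (continuous_infDist_pt _).div_const 10

lemma measurableSet_dd (Ω : Set (En n)) :
    MeasurableSet {w : En n × En n | w.2 ∈ ball w.1 (dd Ω w.1)} := by
  have : IsOpen {w : En n × En n | dist w.2 w.1 < dd Ω w.1} :=
    isOpen_lt (continuous_snd.dist continuous_fst) ((continuous_dd Ω).comp continuous_fst)
  exact this.measurableSet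

lemma measurable_ballInt [SFinite μ] (Ω : Set (En n)) {f : En n → ℝ≥0∞} (hf : Measurable f) :
    Measurable (fun y => ∫⁻ z in ball y (dd Ω y), f z ∂μ) := by
  have h : (fun y => ∫⁻ z in ball y (dd Ω y), f z ∂μ) =
      fun y => ∫⁻ z, {w : En n × En n | w.2 ∈ ball w.1 (dd Ω w.1)}.indicator
        (fun w => f w.2) (y, z) ∂μ := by
    ext y
    rw [← lintegral_indicator measurableSet_ball]
    refine lintegral_congr fun z => ?_
    simp only [indicator, mem_ofPred_eq]
  rw [h]
  exact Measurable.lintegral_prod_right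
    ((hf.comp measurable_snd).indicator (measurableSet_dd Ω))

lemma measurable_ballMeas [SFinite μ] (Ω : Set (En n)) :
    Measurable (fun y => μ (ball y (dd Ω y))) := by
  have := measurable_ballInt (μ := μ) Ω (f := fun _ => 1) measurable_const
  simpa using this

lemma measurable_lavg [SFinite μ] (Ω : Set (En n)) {f : En n → ℝ≥0∞} (hf : Measurable f) :
    Measurable (lavg μ Ω f) :=
  (measurable_ballMeas Ω).inv.mul (measurable_ballInt Ω hf)

lemma measurable_good [SFinite μ] {Ω : Set (En n)} (hΩ : IsOpen Ω) {f : En n → ℝ≥0∞}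
    (hf : Measurable f) : Measurable (good μ Ω f) :=
  ((measurable_lavg Ω hf).indicator hΩ.measurableSet).add
    (hf.indicator hΩ.measurableSet.compl)

lemma measurable_ker [SFinite μ] (Ω : Set (En n)) :
    Measurable (fun w : En n × En n => ker μ Ω w.1 w.2) := by
  have : (fun w : En n × En n => ker μ Ω w.1 w.2) = fun w => (μ (ball w.1 (dd Ω w.1)))⁻¹ *
      {w : En n × En n | w.2 ∈ ball w.1 (dd Ω w.1)}.indicator 1 w := by
    ext w; simp [ker, indicator]
  rw [this]
  exact ((measurable_ballMeas Ω).inv.comp measurable_fst).mul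
    (measurable_one.indicator (measurableSet_dd Ω))

lemma tonelli (hD : Dbl μ D) (Ω : Set (En n)) {f : En n → ℝ≥0∞}
    (hf : Measurable f) (A : Set (En n)) :
    ∫⁻ y in A, lavg μ Ω f y ∂μ = ∫⁻ z, f z * ∫⁻ y in A, ker μ Ω y z ∂μ ∂μ := by
  have := hD.locFin
  calc ∫⁻ y in A, lavg μ Ω f y ∂μ = ∫⁻ y in A, ∫⁻ z, f z * ker μ Ω y z ∂μ ∂μ := by
        refine lintegral_congr fun y => ?_
        rw [lavg, ← lintegral_indicator measurableSet_ball, ← lintegral_const_mul _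
          (hf.indicator measurableSet_ball)]
        refine lintegral_congr fun z => ?_
        simp only [ker, indicator]
        split_ifs
        · simp [mul_comm]
        · simp
    _ = ∫⁻ z, ∫⁻ y in A, f z * ker μ Ω y z ∂μ ∂μ := by
        have hk : Measurable (fun w : En n × En n => f w.2 * ker μ Ω w.1 w.2) :=
          (hf.comp measurable_snd).mul (measurable_ker (μ := μ) Ω)
        exact lintegral_lintegral_swap (f := fun y z => f z * ker μ Ω y z) hk.aemeasurable
    _ = ∫⁻ z, f z * ∫⁻ y in A, ker μ Ω y z ∂μ ∂μ := by
        have hk : ∀ z, Measurable (fun y => ker μ Ω y z) := fun z =>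
          Measurable.comp (g := fun w : En n × En n => ker μ Ω w.1 w.2) (f := fun y => (y, z))
            (measurable_ker (μ := μ) Ω) (by fun_prop)
        have hz : ∀ z, ∫⁻ y in A, f z * ker μ Ω y z ∂μ = f z * ∫⁻ y in A, ker μ Ω y z ∂μ :=
          fun z => lintegral_const_mul (f z) (hk z)
        simp only [hz]

lemma ker_upper (hD : Dbl μ D) (Ω : Set (En n)) (A : Set (En n)) (z : En n) :
    ∫⁻ y in A, ker μ Ω y z ∂μ ≤ (D : ℝ≥0∞) ^ 2 := by
  set B := ball z (2 * dd Ω z) with hB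
  calc ∫⁻ y in A, ker μ Ω y z ∂μ ≤ ∫⁻ y, ker μ Ω y z ∂μ := setLIntegral_le_lintegral _ _
    _ ≤ ∫⁻ y, B.indicator (fun _ => (D : ℝ≥0∞) ^ 2 * (μ B)⁻¹) y ∂μ := by
        refine lintegral_mono fun y => ?_
        unfold ker
        by_cases hz : z ∈ ball y (dd Ω y)
        · have hdy : 0 < dd Ω y := pos_of_mem_ball hz
          have hzy : dist z y < dd Ω y := hz
          have h1 := dd_lip Ω y z
          have h2 := dd_lip Ω z y
          rw [dist_comm y z] at h1
          have hyB : y ∈ B := by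
            rw [hB, mem_ball, dist_comm]; linarith
          have hsub : B ⊆ ball y (4 * dd Ω y) := by
            refine ball_subset_ball' ?_
            linarith
          have hle : μ B ≤ (D : ℝ≥0∞) ^ 2 * μ (ball y (dd Ω y)) :=
            (measure_mono hsub).trans (hD.dbl4 _ _ hdy)
          have hB0 : μ B ≠ 0 := (hD.pos _ _ (by linarith)).ne'
          have hBt : μ B ≠ ⊤ := (hD.fin _ _).ne
          have hb0 := (hD.pos y _ hdy).ne'
          have hbt := (hD.fin y (dd Ω y)).ne
          simp only [indicator, hz, hyB, if_true, Pi.one_apply, mul_one]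
          rw [← div_eq_mul_inv, ENNReal.le_div_iff_mul_le (Or.inl hB0) (Or.inl hBt)]
          calc _ ≤ (μ (ball y (dd Ω y)))⁻¹ * ((D : ℝ≥0∞) ^ 2 * μ (ball y (dd Ω y))) := by gcongr
            _ = (D : ℝ≥0∞) ^ 2 * ((μ (ball y (dd Ω y)))⁻¹ * μ (ball y (dd Ω y))) := by ring
            _ = _ := by rw [ENNReal.inv_mul_cancel hb0 hbt, mul_one]
        · simp [indicator, hz]
    _ = (D : ℝ≥0∞) ^ 2 * ((μ B)⁻¹ * μ B) := by
        rw [lintegral_indicator_const measurableSet_ball, mul_assoc]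
    _ ≤ (D : ℝ≥0∞) ^ 2 * 1 := by gcongr; exact ENNReal.inv_mul_le_one _
    _ = _ := mul_one _

lemma ker_lower (hD : Dbl μ D) {Ω : Set (En n)} (hΩ : IsOpen Ω) {x c : En n} {ρ : ℝ}
    (hx : x ∉ Ω) (hxc : x ∈ ball c ρ) {z : En n} (hz : z ∈ Ω) (hzc : z ∈ ball c ρ) :
    1 ≤ (D : ℝ≥0∞) ^ 2 * ∫⁻ y in Ω ∩ ball c (2 * ρ), ker μ Ω y z ∂μ := by
  have hdz := dd_pos hΩ ⟨x, hx⟩ hz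
  set B := ball z (dd Ω z / 2) with hB
  have hρ : dd Ω z < ρ / 5 := by
    have h1 : infDist z Ωᶜ ≤ dist z x := infDist_le_dist_of_mem hx
    have h2 : dist z x ≤ dist z c + dist x c := dist_triangle_right z x c
    rw [mem_ball] at hxc hzc
    unfold dd; linarith
  have hBsub : B ⊆ Ω ∩ ball c (2 * ρ) := by
    intro y hy
    have hy' : dist y z < dd Ω z / 2 := hy
    have h1 := dd_lip Ω z y
    rw [dist_comm] at h1
    refine ⟨mem_of_dd_pos (by linarith), ?_⟩
    have := dist_triangle y z c
    rw [mem_ball] at hzc ⊢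
    linarith
  have hB0 : μ B ≠ 0 := (hD.pos _ _ (by linarith)).ne'
  have hBt : μ B ≠ ⊤ := (hD.fin _ _).ne
  have hpt : ∀ y ∈ B, (μ B)⁻¹ ≤ (D : ℝ≥0∞) ^ 2 * ker μ Ω y z := by
    intro y hy
    have hy' : dist y z < dd Ω z / 2 := hy
    have h1 := dd_lip Ω z y
    have h2 := dd_lip Ω y z
    rw [dist_comm] at h1
    have hdy : 0 < dd Ω y := by linarith
    have hzy : z ∈ ball y (dd Ω y) := by rw [mem_ball, dist_comm]; linarith
    have hb0 := (hD.pos y _ hdy).ne'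
    have hbt := (hD.fin y (dd Ω y)).ne
    have hle : μ (ball y (dd Ω y)) ≤ (D : ℝ≥0∞) ^ 2 * μ B := by
      refine (measure_mono ?_).trans (hD.dbl4 _ _ (by linarith))
      exact ball_subset_ball' (by linarith)
    simp only [ker, indicator, hzy, if_true, Pi.one_apply, mul_one]
    rw [← div_eq_mul_inv, ENNReal.le_div_iff_mul_le (Or.inl hb0) (Or.inl hbt)]
    calc _ ≤ (μ B)⁻¹ * ((D : ℝ≥0∞) ^ 2 * μ B) := by gcongr
      _ = (D : ℝ≥0∞) ^ 2 * ((μ B)⁻¹ * μ B) := by ring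
      _ = _ := by rw [ENNReal.inv_mul_cancel hB0 hBt, mul_one]
  calc (1 : ℝ≥0∞) = ∫⁻ y in B, (μ B)⁻¹ ∂μ := by
        rw [setLIntegral_const, ENNReal.inv_mul_cancel hB0 hBt]
    _ ≤ ∫⁻ y in B, (D : ℝ≥0∞) ^ 2 * ker μ Ω y z ∂μ := setLIntegral_mono' measurableSet_ball hpt
    _ = (D : ℝ≥0∞) ^ 2 * ∫⁻ y in B, ker μ Ω y z ∂μ := by
        rw [lintegral_const_mul' _ _ (by finiteness)]
    _ ≤ _ := by gcongr

lemma good_int (hD : Dbl μ D) {Ω : Set (En n)} (hΩ : IsOpen Ω) {f : En n → ℝ≥0∞}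
    (hf : Measurable f) : ∫⁻ y, good μ Ω f y ∂μ ≤ ((D : ℝ≥0∞) ^ 2 + 1) * ∫⁻ y, f y ∂μ := by
  unfold good
  rw [lintegral_add_right _ (hf.indicator hΩ.measurableSet.compl),
    lintegral_indicator hΩ.measurableSet, tonelli hD Ω hf, add_mul, one_mul]
  gcongr
  · rw [← lintegral_const_mul _ hf]
    refine lintegral_mono fun z => ?_
    rw [mul_comm]
    exact mul_le_mul_left (ker_upper hD Ω Ω z) _
  · exact indicator_le_self _ _ _

lemma uMax_le_good (hD : Dbl μ D) {Ω : Set (En n)} (hΩ : IsOpen Ω) {f : En n → ℝ≥0∞}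
    (hf : Measurable f) {x : En n} (hx : x ∉ Ω) :
    uMax μ f x ≤ ((D : ℝ≥0∞) ^ 3 + 1) * uMax μ (good μ Ω f) x := by
  refine uMax_le fun c ρ hxc => ?_
  have hρ : 0 < ρ := pos_of_mem_ball hxc
  set g := good μ Ω f with hg
  have hB0 := (hD.pos c ρ hρ).ne'
  have hBt := (hD.fin c ρ).ne
  have hB20 := (hD.pos c (2 * ρ) (by linarith)).ne'
  have hB2t := (hD.fin c (2 * ρ)).ne
  have h1 : ∫⁻ y in ball c ρ ∩ Ω, f y ∂μ ≤ (D : ℝ≥0∞) ^ 2 * ∫⁻ y in ball c (2 * ρ), g y ∂μ := by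
    calc ∫⁻ y in ball c ρ ∩ Ω, f y ∂μ
        ≤ ∫⁻ z in ball c ρ ∩ Ω, f z * ((D : ℝ≥0∞) ^ 2 *
            ∫⁻ y in Ω ∩ ball c (2 * ρ), ker μ Ω y z ∂μ) ∂μ := by
          refine setLIntegral_mono' (measurableSet_ball.inter hΩ.measurableSet) fun z hz => ?_
          conv_lhs => rw [← mul_one (f z)]
          gcongr
          exact ker_lower hD hΩ hx hxc hz.2 hz.1
      _ ≤ ∫⁻ z, f z * ((D : ℝ≥0∞) ^ 2 *
            ∫⁻ y in Ω ∩ ball c (2 * ρ), ker μ Ω y z ∂μ) ∂μ := setLIntegral_le_lintegral _ _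
      _ = (D : ℝ≥0∞) ^ 2 * ∫⁻ y in Ω ∩ ball c (2 * ρ), lavg μ Ω f y ∂μ := by
          rw [tonelli hD Ω hf, ← lintegral_const_mul' _ _ (by finiteness)]
          refine lintegral_congr fun z => ?_
          ring
      _ ≤ (D : ℝ≥0∞) ^ 2 * ∫⁻ y in Ω ∩ ball c (2 * ρ), g y ∂μ := by
          gcongr 1
          refine setLIntegral_mono' (hΩ.measurableSet.inter measurableSet_ball) fun y hy => ?_
          rw [hg, good, indicator_of_mem hy.1]
          exact le_self_add
      _ ≤ _ := by
          gcongr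
          exact inter_subset_right
  have h2 : ∫⁻ y in ball c ρ \ Ω, f y ∂μ ≤ ∫⁻ y in ball c ρ, g y ∂μ := by
    calc ∫⁻ y in ball c ρ \ Ω, f y ∂μ ≤ ∫⁻ y in ball c ρ \ Ω, g y ∂μ := by
          refine setLIntegral_mono' (measurableSet_ball.diff hΩ.measurableSet) fun y hy => ?_
          rw [hg, good, indicator_of_mem (show y ∈ Ωᶜ from hy.2)]
          exact le_add_self
      _ ≤ _ := by gcongr; exact sdiff_subset
  have h3 : (μ (ball c ρ))⁻¹ ≤ D * (μ (ball c (2 * ρ)))⁻¹ := by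
    rw [← div_eq_mul_inv, ENNReal.le_div_iff_mul_le (Or.inl hB20) (Or.inl hB2t)]
    calc _ ≤ (μ (ball c ρ))⁻¹ * (D * μ (ball c ρ)) := by gcongr; exact hD.dbl c ρ hρ
      _ = D * ((μ (ball c ρ))⁻¹ * μ (ball c ρ)) := by ring
      _ = D := by rw [ENNReal.inv_mul_cancel hB0 hBt, mul_one]
  rw [← lintegral_inter_add_sdiff f (ball c ρ) hΩ.measurableSet, mul_add, add_mul, one_mul]
  refine add_le_add ?_ ?_
  · calc (μ (ball c ρ))⁻¹ * ∫⁻ y in ball c ρ ∩ Ω, f y ∂μ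
        ≤ (D * (μ (ball c (2 * ρ)))⁻¹) * ((D : ℝ≥0∞) ^ 2 * ∫⁻ y in ball c (2 * ρ), g y ∂μ) := by
          gcongr
      _ = (D : ℝ≥0∞) ^ 3 * ((μ (ball c (2 * ρ)))⁻¹ * ∫⁻ y in ball c (2 * ρ), g y ∂μ) := by ring
      _ ≤ _ := by
          gcongr
          exact le_uMax g (ball_subset_ball (by linarith) hxc)
  · calc (μ (ball c ρ))⁻¹ * ∫⁻ y in ball c ρ \ Ω, f y ∂μ
        ≤ (μ (ball c ρ))⁻¹ * ∫⁻ y in ball c ρ, g y ∂μ := by gcongr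
      _ ≤ _ := le_uMax g hxc

end FS

namespace FS

open Metric Filter Topology

variable {n : ℕ} {μ : Measure (En n)} {D : ℝ≥0}

lemma ae_le_of_uMax_le (hD : Dbl μ D) {F : En n → ℝ≥0∞} (hF : Measurable F)
    (hfin : ∫⁻ y, F y ∂μ ≠ ⊤) (a : ℝ≥0∞) :
    ∀ᵐ x ∂μ, uMax μ F x ≤ a → F x ≤ D * a := by
  have := hD.locFin
  filter_upwards [(Besicovitch.vitaliFamily μ).ae_tendsto_lintegral_div hF.aemeasurable hfin]
    with x hx hxa
  have h1 := hx.comp (Besicovitch.tendsto_filterAt μ x)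
  refine le_of_tendsto h1 ?_
  filter_upwards [self_mem_nhdsWithin] with ρ hρ
  have hρ : 0 < ρ := hρ
  have hB0 := (hD.pos x ρ hρ).ne'
  have hBt := (hD.fin x ρ).ne
  have hB20 := (hD.pos x (2 * ρ) (by linarith)).ne'
  have hB2t := (hD.fin x (2 * ρ)).ne
  have h2 : ∫⁻ y in closedBall x ρ, F y ∂μ ≤ a * μ (ball x (2 * ρ)) := by
    calc ∫⁻ y in closedBall x ρ, F y ∂μ ≤ ∫⁻ y in ball x (2 * ρ), F y ∂μ := by
          gcongr; exact closedBall_subset_ball (by linarith)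
      _ = μ (ball x (2 * ρ)) * ((μ (ball x (2 * ρ)))⁻¹ * ∫⁻ y in ball x (2 * ρ), F y ∂μ) := by
          rw [← mul_assoc, ENNReal.mul_inv_cancel hB20 hB2t, one_mul]
      _ ≤ μ (ball x (2 * ρ)) * a := by
          gcongr
          exact (le_uMax F (mem_ball_self (by linarith))).trans hxa
      _ = _ := mul_comm _ _
  simp only [Function.comp]
  refine ENNReal.div_le_of_le_mul (h2.trans ?_)
  calc a * μ (ball x (2 * ρ)) ≤ a * (D * μ (closedBall x ρ)) := by
        gcongr
        exact (hD.dbl x ρ hρ).trans (by gcongr; exact ball_subset_closedBall)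
    _ = _ := by ring

lemma lavg_le (hD : Dbl μ D) {Ω : Set (En n)} (hΩ : IsOpen Ω) (hne : (Ωᶜ).Nonempty)
    {F : En n → ℝ≥0∞} {a : ℝ≥0∞} (hF : ∀ x ∉ Ω, uMax μ F x ≤ a) {y : En n} (hy : y ∈ Ω) :
    lavg μ Ω F y ≤ (D : ℝ≥0∞) ^ 5 * a := by
  have hdy := dd_pos hΩ hne hy
  obtain ⟨z, hz, hyz⟩ := (infDist_lt_iff hne (x := y) (r := 32 * dd Ω y)).1
    (by unfold dd at hdy ⊢; linarith)
  have hzB : z ∈ ball y (32 * dd Ω y) := by rw [mem_ball, dist_comm]; exact hyz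
  have hb0 := (hD.pos y _ hdy).ne'
  have hbt := (hD.fin y (dd Ω y)).ne
  have hB0 := (hD.pos y (32 * dd Ω y) (by linarith)).ne'
  have hBt := (hD.fin y (32 * dd Ω y)).ne
  have h32 : μ (ball y (32 * dd Ω y)) ≤ (D : ℝ≥0∞) ^ 5 * μ (ball y (dd Ω y)) := by
    have e : 32 * dd Ω y = 8 * (4 * dd Ω y) := by ring
    rw [e]
    calc _ ≤ (D : ℝ≥0∞) ^ 3 * μ (ball y (4 * dd Ω y)) := hD.dbl8 _ _ (by linarith)
      _ ≤ (D : ℝ≥0∞) ^ 3 * ((D : ℝ≥0∞) ^ 2 * μ (ball y (dd Ω y))) := by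
          gcongr; exact hD.dbl4 _ _ hdy
      _ = _ := by ring
  unfold lavg
  calc _ ≤ (μ (ball y (dd Ω y)))⁻¹ * ∫⁻ z in ball y (32 * dd Ω y), F z ∂μ := by
        gcongr; linarith
    _ = (μ (ball y (dd Ω y)))⁻¹ * (μ (ball y (32 * dd Ω y)) *
          ((μ (ball y (32 * dd Ω y)))⁻¹ * ∫⁻ z in ball y (32 * dd Ω y), F z ∂μ)) := by
        congr 1
        rw [← mul_assoc, ENNReal.mul_inv_cancel hB0 hBt, one_mul]
    _ ≤ (μ (ball y (dd Ω y)))⁻¹ * (((D : ℝ≥0∞) ^ 5 * μ (ball y (dd Ω y))) * a) := by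
        gcongr
        exact (le_uMax F hzB).trans (hF z hz)
    _ = (D : ℝ≥0∞) ^ 5 * a * ((μ (ball y (dd Ω y)))⁻¹ * μ (ball y (dd Ω y))) := by ring
    _ = _ := by rw [ENNReal.inv_mul_cancel hb0 hbt, mul_one]

lemma lr_good_le (hD : Dbl μ D) {r : ℝ} (hr : 1 < r) (Ω : Set (En n))
    {f : ℕ → En n → ℝ≥0∞} (hf : ∀ j, Measurable (f j)) (y : En n) :
    lr r (fun j => good μ Ω (f j) y) ≤ good μ Ω (fun x => lr r (fun j => f j x)) y := by
  have hr0 : 0 < r := by linarith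
  by_cases hy : y ∈ Ω
  · simp only [good, indicator, hy, mem_compl_iff, not_true, if_true, if_false, add_zero, lavg]
    rw [lr_const_mul hr0]
    gcongr
    exact minkowski _ hr hf
  · simp [good, indicator, hy]

lemma weak_vv_one (D : ℝ≥0) (r : ℝ) (hr : 1 < r) : ∃ C : ℝ≥0, ∀ (μ : Measure (En n)), Dbl μ D →
    ∀ f : ℕ → En n → ℝ≥0∞, (∀ j, Measurable (f j)) → ∀ a : ℝ≥0, 0 < a →
      a * μ {x | a < lr r (fun j => uMax μ (f j) x)} ≤
        C * ∫⁻ x, lr r (fun j => f j x) ∂μ := by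
  have hr0 : 0 < r := by linarith
  set Cs : ℝ≥0 := 2 * D ^ 3 * Real.toNNReal r * (Real.toNNReal (r - 1))⁻¹ * 2 ^ (r - 1) with hCs
  set C1 : ℝ≥0 := (D ^ 3 + 1) ^ r * (Cs * ((D ^ 5 + D) ^ (r - 1) * (D ^ 2 + 1))) with hC1
  refine ⟨D ^ 3 + C1, fun μ hD f hf a ha => ?_⟩
  have := hD.locFin
  set F : En n → ℝ≥0∞ := fun x => lr r (fun j => f j x) with hFdef
  have hF : Measurable F := measurable_lr r hf
  set Ω := {x | (a : ℝ≥0∞) < uMax μ F x} with hΩdef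
  have hΩ : IsOpen Ω := isOpen_lt_uMax F a
  have hweak : a * μ Ω ≤ (D : ℝ≥0∞) ^ 3 * ∫⁻ y, F y ∂μ := weak_type hD F a
  set E := {x | (a : ℝ≥0∞) < lr r (fun j => uMax μ (f j) x)} with hE
  rcases eq_or_ne (∫⁻ y, F y ∂μ) ⊤ with hT | hT
  · rw [hT]
    rcases eq_or_ne D 0 with h0 | h0
    · exfalso
      have h1 := hD.dbl 0 1 one_pos
      have h2 := hD.pos 0 (2 * 1) (by norm_num)
      rw [h0] at h1
      simp only [ENNReal.coe_zero, zero_mul] at h1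
      exact absurd h1 (not_le.2 h2)
    · have : ((D ^ 3 + C1 : ℝ≥0) : ℝ≥0∞) ≠ 0 := by
        have : 0 < D := pos_iff_ne_zero.2 h0
        have : 0 < D ^ 3 + C1 := by positivity
        exact_mod_cast this.ne'
      rw [ENNReal.mul_top this]
      exact le_top
  have hsplit : μ E ≤ μ Ω + μ (E \ Ω) := by
    refine (measure_mono ?_).trans (measure_union_le _ _)
    intro x hx
    by_cases h : x ∈ Ω
    · exact Or.inl h
    · exact Or.inr ⟨hx, h⟩
  have hmain : a * μ (E \ Ω) ≤ C1 * ∫⁻ y, F y ∂μ := by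
    by_cases hne : (Ωᶜ).Nonempty
    swap
    · have : E \ Ω = ∅ := by
        rw [not_nonempty_iff_eq_empty] at hne
        rw [sdiff_eq, hne]; simp
      rw [this]; simp
    set g : ℕ → En n → ℝ≥0∞ := fun j => good μ Ω (f j) with hg
    have hgm : ∀ j, Measurable (g j) := fun j => measurable_good hΩ (hf j)
    set H := good μ Ω F with hH
    have hHm : Measurable H := measurable_good hΩ hF
    have hHle : ∀ᵐ y ∂μ, H y ≤ ((D ^ 5 + D) * a : ℝ≥0) := by
      filter_upwards [ae_le_of_uMax_le hD hF hT a] with y hy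
      push_cast
      rw [hH, good, add_mul]
      by_cases hyΩ : y ∈ Ω
      · simp only [indicator, hyΩ, mem_compl_iff, not_true, if_true, if_false, add_zero]
        refine (lavg_le hD hΩ hne (fun x hx => ?_) hyΩ).trans le_self_add
        exact not_lt.1 hx
      · simp only [indicator, hyΩ, mem_compl_iff, not_false_eq_true, if_true, if_false, zero_add]
        exact (hy (not_lt.1 hyΩ)).trans le_add_self
    have hr1 : 0 < r - 1 := by linarith
    have hGr : ∫⁻ y, ∑' j, g j y ^ r ∂μ ≤ (((D ^ 5 + D) * a) ^ (r - 1) : ℝ≥0) *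
        (((D : ℝ≥0∞) ^ 2 + 1) * ∫⁻ y, F y ∂μ) := by
      calc ∫⁻ y, ∑' j, g j y ^ r ∂μ ≤ ∫⁻ y, (((D ^ 5 + D) * a) ^ (r - 1) : ℝ≥0) * H y ∂μ := by
            refine lintegral_mono_ae ?_
            filter_upwards [hHle] with y hy
            rw [← lr_rpow hr0]
            calc _ ≤ H y ^ r := by gcongr; exact lr_good_le hD hr Ω hf y
              _ = H y ^ (r - 1) * H y := by
                  conv_lhs => rw [show r = (r - 1) + 1 by ring]
                  rw [ENNReal.rpow_add_of_nonneg _ _ hr1.le zero_le_one, ENNReal.rpow_one]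
              _ ≤ _ := by
                  rw [ENNReal.coe_rpow_of_nonneg _ hr1.le]
                  gcongr
        _ = (((D ^ 5 + D) * a) ^ (r - 1) : ℝ≥0) * ∫⁻ y, H y ∂μ := lintegral_const_mul _ hHm
        _ ≤ _ := by gcongr; exact good_int hD hΩ hF
    have hstr : ∫⁻ x, ∑' j, uMax μ (g j) x ^ r ∂μ ≤ Cs * ∫⁻ y, ∑' j, g j y ^ r ∂μ := by
      rw [lintegral_tsum fun j => ((measurable_uMax _).pow_const r).aemeasurable,
        lintegral_tsum fun j => ((hgm j).pow_const r).aemeasurable, ← ENNReal.tsum_mul_left]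
      exact ENNReal.tsum_le_tsum fun j => strong_type hD r hr (hgm j)
    have hcheb : (a : ℝ≥0∞) ^ r * μ (E \ Ω) ≤ ((D ^ 3 + 1) ^ r : ℝ≥0) *
        ∫⁻ x, ∑' j, uMax μ (g j) x ^ r ∂μ := by
      have hEm : MeasurableSet (E \ Ω) :=
        (measurableSet_lt measurable_const
          (measurable_lr r fun j => measurable_uMax (f j))).diff hΩ.measurableSet
      calc (a : ℝ≥0∞) ^ r * μ (E \ Ω) = ∫⁻ x in E \ Ω, (a : ℝ≥0∞) ^ r ∂μ := by
            rw [setLIntegral_const]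
        _ ≤ ∫⁻ x in E \ Ω, ((D ^ 3 + 1) ^ r : ℝ≥0) * ∑' j, uMax μ (g j) x ^ r ∂μ := by
            refine setLIntegral_mono' hEm fun x hx => ?_
            have h1 : (a : ℝ≥0∞) ≤ ((D : ℝ≥0∞) ^ 3 + 1) * lr r (fun j => uMax μ (g j) x) := by
              rw [← lr_const_mul hr0]
              refine (le_of_lt hx.1).trans (lr_mono hr0 fun j => ?_)
              exact uMax_le_good hD hΩ (hf j) hx.2
            calc (a : ℝ≥0∞) ^ r ≤ (((D : ℝ≥0∞) ^ 3 + 1) * lr r (fun j => uMax μ (g j) x)) ^ r := by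
                  gcongr
              _ = _ := by
                  rw [ENNReal.mul_rpow_of_nonneg _ _ hr0.le, lr_rpow hr0,
                    ENNReal.coe_rpow_of_nonneg _ hr0.le]
                  push_cast; rfl
        _ ≤ ∫⁻ x, ((D ^ 3 + 1) ^ r : ℝ≥0) * ∑' j, uMax μ (g j) x ^ r ∂μ :=
            setLIntegral_le_lintegral _ _
        _ = _ := lintegral_const_mul' _ _ ENNReal.coe_ne_top
    have hfinal : (a : ℝ≥0∞) ^ r * μ (E \ Ω) ≤ (a : ℝ≥0∞) ^ (r - 1) * (C1 * ∫⁻ y, F y ∂μ) := by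
      refine hcheb.trans ?_
      calc _ ≤ (((D ^ 3 + 1) ^ r : ℝ≥0) : ℝ≥0∞) * (Cs * ((((D ^ 5 + D) * a) ^ (r - 1) : ℝ≥0) *
            (((D : ℝ≥0∞) ^ 2 + 1) * ∫⁻ y, F y ∂μ))) := by
              gcongr; exact hstr.trans (by gcongr)
        _ = _ := by
            rw [hC1, NNReal.mul_rpow, ← ENNReal.coe_rpow_of_nonneg a hr1.le]
            push_cast
            ring
    have ha0 : (a : ℝ≥0∞) ^ (r - 1) ≠ 0 := by
      simp [ENNReal.rpow_eq_zero_iff, ha.ne']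
    have hat : (a : ℝ≥0∞) ^ (r - 1) ≠ ⊤ :=
      (ENNReal.rpow_lt_top_of_nonneg hr1.le ENNReal.coe_ne_top).ne
    have hsp : (a : ℝ≥0∞) ^ r = (a : ℝ≥0∞) ^ (r - 1) * a := by
      conv_lhs => rw [show r = (r - 1) + 1 by ring]
      rw [ENNReal.rpow_add_of_nonneg _ _ hr1.le zero_le_one, ENNReal.rpow_one]
    rw [hsp, mul_assoc] at hfinal
    exact (ENNReal.mul_le_mul_iff_right ha0 hat).1 hfinal
  calc (a : ℝ≥0∞) * μ E ≤ a * (μ Ω + μ (E \ Ω)) := by gcongr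
    _ = a * μ Ω + a * μ (E \ Ω) := mul_add _ _ _
    _ ≤ (D : ℝ≥0∞) ^ 3 * ∫⁻ y, F y ∂μ + C1 * ∫⁻ y, F y ∂μ := add_le_add hweak hmain
    _ = _ := by push_cast; ring

end FS

namespace FS

open Metric Filter Topology

variable {n : ℕ} {μ : Measure (En n)} {D : ℝ≥0}

lemma avg_le_weight {w : En n → ℝ≥0∞} {A : ℝ≥0} (hA : ∀ x, uMax μ w x ≤ A * w x)
    {c y : En n} {ρ : ℝ} (hy : y ∈ ball c ρ) :
    (μ.withDensity w) (ball c ρ) * (μ (ball c ρ))⁻¹ ≤ A * w y := by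
  rw [withDensity_apply _ measurableSet_ball, mul_comm]
  exact (le_uMax w hy).trans (hA y)

lemma dbl_withDensity (hD : Dbl μ D) {w : En n → ℝ≥0∞} (hw : Measurable w) (hpos : ∀ x, w x ≠ 0)
    (hfin : ∀ c ρ, ∫⁻ x in ball c ρ, w x ∂μ < ⊤) {A : ℝ≥0}
    (hA : ∀ x, uMax μ w x ≤ A * w x) : Dbl (μ.withDensity w) (A * D) := by
  refine ⟨fun c ρ hρ => ?_, fun c ρ => ?_, fun c ρ hρ => ?_⟩
  · rw [withDensity_apply _ measurableSet_ball, setLIntegral_pos_iff hw]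
    have : Function.support w = univ := by
      ext x; simp [hpos x]
    rw [this, univ_inter]
    exact hD.pos c ρ hρ
  · rw [withDensity_apply _ measurableSet_ball]; exact hfin c ρ
  · set ν := μ.withDensity w with hν
    have hB0 := (hD.pos c ρ hρ).ne'
    have hBt := (hD.fin c ρ).ne
    have hB20 := (hD.pos c (2 * ρ) (by linarith)).ne'
    have hB2t := (hD.fin c (2 * ρ)).ne
    have h1 : ν (ball c (2 * ρ)) * (μ (ball c (2 * ρ)))⁻¹ * μ (ball c ρ) ≤ A * ν (ball c ρ) := by
      calc _ = ∫⁻ y in ball c ρ, ν (ball c (2 * ρ)) * (μ (ball c (2 * ρ)))⁻¹ ∂μ := by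
            rw [setLIntegral_const]
        _ ≤ ∫⁻ y in ball c ρ, A * w y ∂μ := by
            refine setLIntegral_mono' measurableSet_ball fun y hy => ?_
            exact avg_le_weight hA (ball_subset_ball (by linarith) hy)
        _ = _ := by rw [lintegral_const_mul _ hw, hν, withDensity_apply _ measurableSet_ball]
    have h2 : μ (ball c ρ) * ν (ball c (2 * ρ)) ≤
        μ (ball c ρ) * (((A * D : ℝ≥0) : ℝ≥0∞) * ν (ball c ρ)) := by
      calc _ = ν (ball c (2 * ρ)) * ((μ (ball c (2 * ρ)))⁻¹ * μ (ball c (2 * ρ))) *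
            μ (ball c ρ) := by
              rw [ENNReal.inv_mul_cancel hB20 hB2t, mul_one, mul_comm]
        _ = (ν (ball c (2 * ρ)) * (μ (ball c (2 * ρ)))⁻¹ * μ (ball c ρ)) *
            μ (ball c (2 * ρ)) := by ring
        _ ≤ (A * ν (ball c ρ)) * (D * μ (ball c ρ)) := by
            gcongr; exact hD.dbl c ρ hρ
        _ = _ := by push_cast; ring
    exact (ENNReal.mul_le_mul_iff_right hB0 hBt).1 h2

lemma uMax_le_withDensity (hD : Dbl μ D) {w : En n → ℝ≥0∞} (hw : Measurable w)
    (hpos : ∀ x, w x ≠ 0)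
    (hfin : ∀ c ρ, ∫⁻ x in ball c ρ, w x ∂μ < ⊤) {A : ℝ≥0}
    (hA : ∀ x, uMax μ w x ≤ A * w x) {f : En n → ℝ≥0∞} (hf : Measurable f) (x : En n) :
    uMax μ f x ≤ A * uMax (μ.withDensity w) f x := by
  have hDν := dbl_withDensity hD hw hpos hfin hA
  refine uMax_le fun c ρ hx => ?_
  set ν := μ.withDensity w with hν
  have hρ : 0 < ρ := pos_of_mem_ball hx
  have hν0 := (hDν.pos c ρ hρ).ne'
  have hνt := (hDν.fin c ρ).ne
  have h1 : ν (ball c ρ) * ((μ (ball c ρ))⁻¹ * ∫⁻ y in ball c ρ, f y ∂μ) ≤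
      A * ∫⁻ y in ball c ρ, f y ∂ν := by
    calc _ = ∫⁻ y in ball c ρ, (ν (ball c ρ) * (μ (ball c ρ))⁻¹) * f y ∂μ := by
          rw [lintegral_const_mul _ hf, mul_assoc]
      _ ≤ ∫⁻ y in ball c ρ, A * (w y * f y) ∂μ := by
          refine setLIntegral_mono' measurableSet_ball fun y hy => ?_
          rw [← mul_assoc]
          exact mul_le_mul_left (avg_le_weight hA hy) (f y)
      _ = _ := by
          rw [lintegral_const_mul (A : ℝ≥0∞) (f := fun y => w y * f y) (hw.mul hf), hν, restrict_withDensity measurableSet_ball,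
            lintegral_withDensity_eq_lintegral_mul _ hw hf]
          rfl
  calc (μ (ball c ρ))⁻¹ * ∫⁻ y in ball c ρ, f y ∂μ
      = (ν (ball c ρ))⁻¹ * (ν (ball c ρ) * ((μ (ball c ρ))⁻¹ * ∫⁻ y in ball c ρ, f y ∂μ)) := by
        rw [← mul_assoc, ENNReal.inv_mul_cancel hν0 hνt, one_mul]
    _ ≤ (ν (ball c ρ))⁻¹ * (A * ∫⁻ y in ball c ρ, f y ∂ν) := by gcongr
    _ = A * ((ν (ball c ρ))⁻¹ * ∫⁻ y in ball c ρ, f y ∂ν) := by ring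
    _ ≤ _ := by gcongr; exact le_uMax f hx

/-- Iterates of the maximal operator. -/
def iterM (μ : Measure (En n)) (g : En n → ℝ≥0∞) : ℕ → En n → ℝ≥0∞
  | 0 => g
  | k + 1 => uMax μ (iterM μ g k)

lemma measurable_iterM {g : En n → ℝ≥0∞} (hg : Measurable g) (k : ℕ) :
    Measurable (iterM μ g k) := by
  cases k with
  | zero => exact hg
  | succ k => exact measurable_uMax _

/-- Rubio de Francia algorithm. -/
lemma rubio (hD : Dbl μ D) (N : (En n → ℝ≥0∞) → ℝ≥0∞) (C : ℝ≥0) (hC : 0 < C)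
    (hsum : ∀ g : ℕ → En n → ℝ≥0∞, (∀ k, Measurable (g k)) →
      N (fun x => ∑' k, g k x) ≤ ∑' k, N (g k))
    (hsmul : ∀ (c : ℝ≥0) (g : En n → ℝ≥0∞), Measurable g → N (fun x => c * g x) ≤ c * N g)
    (hM : ∀ g : En n → ℝ≥0∞, Measurable g → N (uMax μ g) ≤ C * N g)
    {g : En n → ℝ≥0∞} (hg : Measurable g) (hg0 : ¬ (g =ᵐ[μ] 0)) :
    ∃ w : En n → ℝ≥0∞, Measurable w ∧ (∀ x, w x ≠ 0) ∧ (∀ x, g x ≤ w x) ∧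
      (∀ x, uMax μ w x ≤ ((2 * C : ℝ≥0) : ℝ≥0∞) * w x) ∧ N w ≤ 2 * N g := by
  set b : ℝ≥0 := (2 * C)⁻¹ with hb
  have hb0 : 0 < b := by positivity
  have hbC : 2 * C * b = 1 := mul_inv_cancel₀ (by positivity)
  set t : ℕ → En n → ℝ≥0∞ := fun k x => ((b ^ k : ℝ≥0) : ℝ≥0∞) * iterM μ g k x with ht
  have htm : ∀ k, Measurable (t k) := fun k => (measurable_iterM hg k).const_mul _
  refine ⟨fun x => ∑' k, t k x, Measurable.tsum htm, fun x => ?_, fun x => ?_, fun x => ?_, ?_⟩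
  · refine (lt_of_lt_of_le ?_ (ENNReal.le_tsum 1)).ne'
    simp only [ht, pow_one]
    exact ENNReal.mul_pos (by exact_mod_cast hb0.ne') (uMax_pos hD hg hg0 x).ne'
  · refine le_trans ?_ (ENNReal.le_tsum 0)
    simp [ht, iterM]
  · refine (uMax_tsum htm x).trans ?_
    have : ∀ k, uMax μ (t k) x = ((2 * C : ℝ≥0) : ℝ≥0∞) * t (k + 1) x := by
      intro k
      simp only [ht]
      rw [uMax_const_mul, ← mul_assoc, ← ENNReal.coe_mul]
      congr 2
      rw [pow_succ, mul_comm (b ^ k), ← mul_assoc, hbC, one_mul]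
    simp_rw [this]
    rw [ENNReal.tsum_mul_left]
    refine mul_le_mul_right ?_ _
    exact ENNReal.tsum_comp_le_tsum_of_injective (add_left_injective 1) (fun k => t k x)
  · refine (hsum t htm).trans ?_
    have hit : ∀ k, N (iterM μ g k) ≤ (C : ℝ≥0∞) ^ k * N g := by
      intro k
      induction k with
      | zero => simp [iterM]
      | succ k ih =>
        calc N (iterM μ g (k + 1)) ≤ C * N (iterM μ g k) := hM _ (measurable_iterM hg k)
          _ ≤ C * ((C : ℝ≥0∞) ^ k * N g) := by gcongr
          _ = _ := by ring
    calc ∑' k, N (t k) ≤ ∑' k : ℕ, (2⁻¹ : ℝ≥0∞) ^ k * N g := by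
          refine ENNReal.tsum_le_tsum fun k => ?_
          refine (hsmul _ _ (measurable_iterM hg k)).trans ?_
          calc _ ≤ ((b ^ k : ℝ≥0) : ℝ≥0∞) * ((C : ℝ≥0∞) ^ k * N g) := by gcongr; exact hit k
            _ = ((b * C : ℝ≥0) : ℝ≥0∞) ^ k * N g := by push_cast; ring
            _ = _ := by
                have : b * C = 2⁻¹ := by
                  refine eq_inv_of_mul_eq_one_left ?_
                  rw [← hbC]; ring
                rw [this, ENNReal.coe_inv (by norm_num)]; rfl
      _ = 2 * N g := by
          rw [ENNReal.tsum_mul_right, ENNReal.tsum_geometric, ENNReal.one_sub_inv_two, inv_inv]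

end FS

namespace FS

open Metric Filter Topology

variable {n : ℕ} {μ : Measure (En n)} {D : ℝ≥0}

lemma Lp_sum_le {p : ℝ} (hp : 1 ≤ p) {g : ℕ → En n → ℝ≥0∞} (hg : ∀ k, Measurable (g k)) (m : ℕ) :
    (∫⁻ x, (∑ k ∈ Finset.range m, g k x) ^ p ∂μ) ^ (1 / p) ≤
      ∑ k ∈ Finset.range m, (∫⁻ x, g k x ^ p ∂μ) ^ (1 / p) := by
  have hp0 : 0 < p := by linarith
  induction m with
  | zero => simp [hp0]
  | succ m ih =>
    simp_rw [Finset.sum_range_succ]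
    refine (ENNReal.lintegral_Lp_add_le (μ := μ) (p := p)
      (f := fun x => ∑ k ∈ Finset.range m, g k x) (g := g m)
      (Finset.measurable_fun_sum _ fun k _ => hg k).aemeasurable (hg m).aemeasurable hp).trans ?_
    gcongr

lemma Lp_tsum_le {p : ℝ} (hp : 1 ≤ p) {g : ℕ → En n → ℝ≥0∞} (hg : ∀ k, Measurable (g k)) :
    (∫⁻ x, (∑' k, g k x) ^ p ∂μ) ^ (1 / p) ≤
      ∑' k, (∫⁻ x, g k x ^ p ∂μ) ^ (1 / p) := by
  have hp0 : 0 < p := by linarith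
  set T := ∑' k, (∫⁻ x, g k x ^ p ∂μ) ^ (1 / p) with hT
  have key : ∫⁻ x, (∑' k, g k x) ^ p ∂μ ≤ T ^ p := by
    have h1 : ∀ x, (∑' k, g k x) ^ p = ⨆ m : ℕ, (∑ k ∈ Finset.range m, g k x) ^ p := by
      intro x
      rw [ENNReal.tsum_eq_iSup_nat]
      exact (ENNReal.orderIsoRpow p hp0).map_iSup _
    simp_rw [h1]
    rw [lintegral_iSup]
    · refine iSup_le fun m => ?_
      have h2 := (Lp_sum_le (μ := μ) hp hg m).trans (ENNReal.sum_le_tsum _)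
      have h3 := ENNReal.rpow_le_rpow h2 hp0.le
      rwa [← ENNReal.rpow_mul, one_div_mul_cancel hp0.ne', ENNReal.rpow_one] at h3
    · intro m
      exact (Finset.measurable_fun_sum _ fun k _ => hg k).pow_const p
    · intro m m' hmm x
      simp only
      gcongr
  have := ENNReal.rpow_le_rpow key (z := 1 / p) (by positivity)
  rwa [← ENNReal.rpow_mul, mul_one_div_cancel hp0.ne', ENNReal.rpow_one] at this

/-- The weak type `(p,p)` vector-valued inequality with constant `C` for all measures
with doubling constant `D`. -/
def WV (n : ℕ) (r p : ℝ) (D C : ℝ≥0) : Prop :=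
  ∀ (μ : Measure (En n)), Dbl μ D →
    ∀ f : ℕ → En n → ℝ≥0∞, (∀ j, Measurable (f j)) → ∀ a : ℝ≥0, 0 < a →
      (a : ℝ≥0∞) ^ p * μ {x | a < lr r (fun j => uMax μ (f j) x)} ≤
        C * ∫⁻ x, lr r (fun j => f j x) ^ p ∂μ

lemma weighted_step {r p : ℝ} (hr : 1 < r) (hp : 1 ≤ p) {A C : ℝ≥0} (hA0 : 0 < A)
    (hWV : WV n r p (A * D) C) (hD : Dbl μ D) {w : En n → ℝ≥0∞} (hw : Measurable w)
    (hpos : ∀ x, w x ≠ 0) (hfin : ∀ c ρ, ∫⁻ x in ball c ρ, w x ∂μ < ⊤)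
    (hA : ∀ x, uMax μ w x ≤ A * w x) {f : ℕ → En n → ℝ≥0∞} (hf : ∀ j, Measurable (f j))
    {a : ℝ≥0} (ha : 0 < a) :
    (a : ℝ≥0∞) ^ p * ∫⁻ x in {x | a < lr r (fun j => uMax μ (f j) x)}, w x ∂μ ≤
      ((A ^ p * C : ℝ≥0) : ℝ≥0∞) * ∫⁻ x, lr r (fun j => f j x) ^ p * w x ∂μ := by
  have hr0 : 0 < r := by linarith
  have hp0 : 0 < p := by linarith
  have hDν := dbl_withDensity hD hw hpos hfin hA
  set ν := μ.withDensity w with hν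
  have hEm : MeasurableSet {x | (a : ℝ≥0∞) < lr r (fun j => uMax μ (f j) x)} :=
    measurableSet_lt measurable_const (measurable_lr r fun j => measurable_uMax (f j))
  have h1 := hWV ν hDν f hf (a / A) (by positivity)
  have hsub : {x | (a : ℝ≥0∞) < lr r (fun j => uMax μ (f j) x)} ⊆
      {x | ((a / A : ℝ≥0) : ℝ≥0∞) < lr r (fun j => uMax ν (f j) x)} := by
    intro x hx
    simp only [mem_ofPred_eq] at hx ⊢
    have h2 : lr r (fun j => uMax μ (f j) x) ≤ A * lr r (fun j => uMax ν (f j) x) := by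
      rw [← lr_const_mul hr0]
      exact lr_mono hr0 fun j => uMax_le_withDensity hD hw hpos hfin hA (hf j) x
    have h3 := hx.trans_le h2
    rw [ENNReal.coe_div hA0.ne']
    exact ENNReal.div_lt_of_lt_mul' h3
  have hI : ∫⁻ x, lr r (fun j => f j x) ^ p * w x ∂μ = ∫⁻ x, lr r (fun j => f j x) ^ p ∂ν := by
    rw [hν, lintegral_withDensity_eq_lintegral_mul _ hw ((measurable_lr r hf).pow_const p)]
    simp only [Pi.mul_apply, mul_comm]
  rw [hI, ← withDensity_apply _ hEm, ← hν]
  have hap : (a : ℝ≥0∞) ^ p = (A : ℝ≥0∞) ^ p * ((a / A : ℝ≥0) : ℝ≥0∞) ^ p := by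
    rw [← ENNReal.mul_rpow_of_nonneg _ _ hp0.le, ← ENNReal.coe_mul, mul_div_cancel₀ _ hA0.ne']
  calc _ ≤ (A : ℝ≥0∞) ^ p * (((a / A : ℝ≥0) : ℝ≥0∞) ^ p *
        ν {x | ((a / A : ℝ≥0) : ℝ≥0∞) < lr r (fun j => uMax ν (f j) x)}) := by
          rw [hap, mul_assoc]; gcongr
    _ ≤ (A : ℝ≥0∞) ^ p * (C * ∫⁻ x, lr r (fun j => f j x) ^ p ∂ν) := by gcongr
    _ = _ := by
        rw [ENNReal.coe_mul, ENNReal.coe_rpow_of_nonneg _ hp0.le, mul_assoc]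

lemma weak_vv (D : ℝ≥0) (r p : ℝ) (hr : 1 < r) (hp : 1 ≤ p) : ∃ C : ℝ≥0, WV n r p D C := by
  rcases hp.eq_or_lt with rfl | hp1
  · obtain ⟨C, hC⟩ := weak_vv_one (n := n) D r hr
    refine ⟨C, fun μ hD f hf a ha => ?_⟩
    simpa using hC μ hD f hf a ha
  have hr0 : 0 < r := by linarith
  have hp0 : 0 < p := by linarith
  set q := p.conjExponent with hq
  have hpq : p.HolderConjugate q := Real.HolderConjugate.conjExponent hp1
  have hq1 : 1 < q := hpq.symm.lt
  have hq0 : 0 < q := by linarith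
  set Cs : ℝ≥0 := 2 * D ^ 3 * Real.toNNReal q * (Real.toNNReal (q - 1))⁻¹ * 2 ^ (q - 1) with hCs
  set C1 : ℝ≥0 := Cs ^ (1 / q) + 1 with hC1
  have hC10 : 0 < C1 := by positivity
  set A : ℝ≥0 := 2 * C1 with hA
  have hA0 : 0 < A := by positivity
  obtain ⟨Cw, hCw⟩ := weak_vv_one (n := n) (A * D) r hr
  have hCw' : WV n r 1 (A * D) Cw := by
    intro μ hD f hf a ha
    simpa using hCw μ hD f hf a ha
  set K : ℝ≥0 := A * Cw * 2 with hK
  refine ⟨K ^ p, fun μ hD f hf a ha => ?_⟩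
  have := hD.locFin
  set F : En n → ℝ≥0∞ := fun x => lr r (fun j => f j x) with hF
  have hFm : Measurable F := measurable_lr r hf
  set E := {x | (a : ℝ≥0∞) < lr r (fun j => uMax μ (f j) x)} with hE
  have hEm : MeasurableSet E :=
    measurableSet_lt measurable_const (measurable_lr r fun j => measurable_uMax (f j))
  have hloc : ∀ m : ℕ, (a : ℝ≥0∞) ^ p * μ (E ∩ ball 0 m) ≤
      ((K ^ p : ℝ≥0) : ℝ≥0∞) * ∫⁻ x, F x ^ p ∂μ := by
    intro m
    set E0 := E ∩ ball 0 (m : ℝ) with hE0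
    have hE0m : MeasurableSet E0 := hEm.inter measurableSet_ball
    rcases eq_or_ne (μ E0) 0 with h0 | h0
    · rw [h0]; simp
    have ht : μ E0 ≠ ⊤ := ((measure_mono inter_subset_right).trans_lt (hD.fin 0 m)).ne
    set v : En n → ℝ≥0∞ := E0.indicator 1 with hv
    have hvm : Measurable v := measurable_one.indicator hE0m
    have hv0 : ¬ (v =ᵐ[μ] 0) := by
      rw [hv, indicator_ae_eq_zero]
      simpa using h0
    set N : (En n → ℝ≥0∞) → ℝ≥0∞ := fun g => (∫⁻ x, g x ^ q ∂μ) ^ (1 / q) with hN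
    have hNv : N v = μ E0 ^ (1 / q) := by
      simp only [hN]
      congr 1
      rw [← lintegral_indicator_one hE0m]
      refine lintegral_congr fun x => ?_
      by_cases hx : x ∈ E0 <;> simp [hv, hx, hq0]
    obtain ⟨h, hhm, hhpos, hvh, hhA, hNh⟩ := rubio hD N C1 hC10
      (fun g hg => Lp_tsum_le hq1.le hg)
      (fun c g hg => by
        simp only [hN]
        simp_rw [ENNReal.mul_rpow_of_nonneg _ _ hq0.le]
        rw [lintegral_const_mul _ (hg.pow_const q), ENNReal.mul_rpow_of_nonneg _ _ (by positivity),
          ← ENNReal.rpow_mul, mul_one_div_cancel hq0.ne', ENNReal.rpow_one])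
      (fun g hg => by
        simp only [hN]
        have h1 := ENNReal.rpow_le_rpow (strong_type hD q hq1 hg) (z := 1 / q) (by positivity)
        refine h1.trans ?_
        rw [ENNReal.mul_rpow_of_nonneg _ _ (by positivity)]
        gcongr
        rw [← ENNReal.coe_rpow_of_nonneg _ (by positivity)]
        exact_mod_cast le_self_add)
      hvm hv0
    have hNht : N h ≠ ⊤ := by
      refine ne_top_of_le_ne_top ?_ hNh
      rw [hNv]
      exact ENNReal.mul_ne_top (by norm_num) (ENNReal.rpow_ne_top_of_nonneg (by positivity) ht)
    have hfin : ∀ c ρ, ∫⁻ x in ball c ρ, h x ∂μ < ⊤ := by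
      intro c ρ
      have h1 := ENNReal.lintegral_mul_le_Lp_mul_Lq μ hpq
        (f := (ball c ρ).indicator 1) (g := h)
        (measurable_one.indicator measurableSet_ball).aemeasurable hhm.aemeasurable
      have h2 : ∫⁻ x in ball c ρ, h x ∂μ = ∫⁻ x, ((ball c ρ).indicator (1 : En n → ℝ≥0∞) * h) x ∂μ := by
        rw [← lintegral_indicator measurableSet_ball]
        refine lintegral_congr fun x => ?_
        by_cases hx : x ∈ ball c ρ <;> simp only [Pi.mul_apply, indicator, hx, if_true, if_false] <;> simp
      rw [h2]
      refine h1.trans_lt (ENNReal.mul_lt_top ?_ hNht.lt_top)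
      refine ENNReal.rpow_lt_top_of_nonneg (by positivity) ?_
      refine ne_top_of_le_ne_top (hD.fin c ρ).ne ?_
      rw [← lintegral_indicator_one measurableSet_ball]
      refine lintegral_mono fun x => ?_
      by_cases hx : x ∈ ball c ρ <;> simp only [indicator, hx, if_true, if_false] <;> simp [hp0]
    have hmain := weighted_step hr le_rfl hA0 hCw' hD hhm hhpos hfin hhA hf ha
    simp only [ENNReal.rpow_one, NNReal.rpow_one] at hmain
    have h4 : (a : ℝ≥0∞) * μ E0 ≤ K * (∫⁻ x, F x ^ p ∂μ) ^ (1 / p) * μ E0 ^ (1 / q) := by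
      calc (a : ℝ≥0∞) * μ E0 ≤ a * ∫⁻ x in E, h x ∂μ := by
            gcongr
            calc μ E0 = ∫⁻ x in E0, 1 ∂μ := by simp
              _ ≤ ∫⁻ x in E0, h x ∂μ := by
                  refine setLIntegral_mono' hE0m fun x hx => ?_
                  simpa [hv, hx] using hvh x
              _ ≤ _ := lintegral_mono_set inter_subset_left
        _ ≤ ((A * Cw : ℝ≥0) : ℝ≥0∞) * ∫⁻ x, F x * h x ∂μ := hmain
        _ ≤ ((A * Cw : ℝ≥0) : ℝ≥0∞) * ((∫⁻ x, F x ^ p ∂μ) ^ (1 / p) * (2 * μ E0 ^ (1 / q))) := by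
            gcongr
            refine (ENNReal.lintegral_mul_le_Lp_mul_Lq μ hpq hFm.aemeasurable
              hhm.aemeasurable).trans ?_
            rw [← hNv]
            exact mul_le_mul_right hNh _
        _ = _ := by rw [hK]; push_cast; ring
    have hmq0 : μ E0 ^ (1 / q) ≠ 0 := by simp [ENNReal.rpow_eq_zero_iff, h0, ht]
    have hmqt : μ E0 ^ (1 / q) ≠ ⊤ := ENNReal.rpow_ne_top_of_nonneg (by positivity) ht
    have h5 : (a : ℝ≥0∞) * μ E0 ^ (1 / p) ≤ K * (∫⁻ x, F x ^ p ∂μ) ^ (1 / p) := by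
      have hm : μ E0 = μ E0 ^ (1 / p) * μ E0 ^ (1 / q) := by
        rw [← ENNReal.rpow_add _ _ h0 ht]
        have : 1 / p + 1 / q = 1 := by
          simpa [one_div] using hpq.inv_add_inv_eq_one
        rw [this, ENNReal.rpow_one]
      refine (ENNReal.mul_le_mul_iff_left hmq0 hmqt).1 ?_
      rw [mul_assoc, ← hm]
      exact h4
    have h6 := ENNReal.rpow_le_rpow h5 hp0.le
    rw [ENNReal.mul_rpow_of_nonneg _ _ hp0.le, ENNReal.mul_rpow_of_nonneg _ _ hp0.le,
      ← ENNReal.rpow_mul, ← ENNReal.rpow_mul, one_div_mul_cancel hp0.ne', ENNReal.rpow_one,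
      ENNReal.rpow_one] at h6
    rwa [ENNReal.coe_rpow_of_nonneg _ hp0.le]
  have hU : E = ⋃ m : ℕ, E ∩ ball 0 (m : ℝ) := by
    rw [← inter_iUnion, iUnion_ball_nat, inter_univ]
  have hmono : Monotone (fun m : ℕ => E ∩ ball (0 : En n) (m : ℝ)) := by
    intro m m' hm
    exact inter_subset_inter_right _ (ball_subset_ball (by exact_mod_cast hm))
  rw [hU, hmono.measure_iUnion, ENNReal.mul_iSup]
  exact iSup_le hloc

end FS

namespace FS

open Metric Filter Topology

variable {n : ℕ}

/-- Function norms with the Fatou property. -/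
structure FNorm (Y : (En n → ℝ≥0∞) → ℝ≥0∞) : Prop where
  mono : ∀ f g, (∀ᵐ x ∂volume, f x ≤ g x) → Y f ≤ Y g
  smul : ∀ (c : ℝ≥0) (f), Y (fun x => (c : ℝ≥0∞) * f x) = (c : ℝ≥0∞) * Y f
  tri : ∀ f g, Y (f + g) ≤ Y f + Y g
  sup : ∀ (f : ℕ → En n → ℝ≥0∞), Monotone f → Y (fun x => ⨆ m, f m x) = ⨆ m, Y (f m)

lemma FNorm.congr {Y : (En n → ℝ≥0∞) → ℝ≥0∞} (hY : FNorm Y) {f g : En n → ℝ≥0∞}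
    (h : ∀ᵐ x ∂volume, f x = g x) : Y f = Y g :=
  le_antisymm (hY.mono _ _ (h.mono fun _ hx => hx.le)) (hY.mono _ _ (h.mono fun _ hx => hx.ge))

lemma FNorm.fatou {Y : (En n → ℝ≥0∞) → ℝ≥0∞} (hY : FNorm Y) {f : ℕ → En n → ℝ≥0∞}
    {g : En n → ℝ≥0∞} (h : ∀ᵐ x ∂volume, Tendsto (fun i => f i x) atTop (𝓝 (g x))) {T : ℝ≥0∞}
    (hT : ∀ i, Y (f i) ≤ T) : Y g ≤ T := by
  have h1 : Y g = Y (fun x => ⨆ m : ℕ, ⨅ i, ⨅ (_ : i ≥ m), f i x) := by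
    refine hY.congr ?_
    filter_upwards [h] with x hx
    rw [← hx.liminf_eq, Filter.liminf_eq_iSup_iInf_of_nat]
  rw [h1, hY.sup (fun m x => ⨅ i, ⨅ (_ : i ≥ m), f i x)]
  · refine iSup_le fun m => (hY.mono _ (f m) (ae_of_all _ fun x => ?_)).trans (hT m)
    exact iInf₂_le m le_rfl
  · intro m m' hm x
    exact le_iInf₂ fun i hi => iInf₂_le i (hm.trans hi)

/-- Extension by zero of the positive part. -/
def ext0 (E : Set (En n)) (a : En n → ℝ) : En n → ℝ≥0∞ :=
  E.indicator (fun x => ENNReal.ofReal (a x))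

lemma separation {Y : (En n → ℝ≥0∞) → ℝ≥0∞} (hY : FNorm Y) {E : Set (En n)}
    (hE : MeasurableSet E) (hEf : volume E < ⊤) {T' : ℝ≥0}
    (hlt : (T' : ℝ≥0∞) < Y (E.indicator 1)) :
    ∃ (g : En n → ℝ) (u : ℝ), Measurable g ∧ 0 < u ∧
      (∀ a : En n → ℝ, Measurable a → (∃ c : ℝ, ∀ x, ‖a x‖ ≤ c) → Y (ext0 E a) ≤ T' →
        Integrable (fun x => a x * g x) (volume.restrict E) ∧
        ∫ x in E, a x * g x < u) ∧
      Integrable g (volume.restrict E) ∧ u < ∫ x in E, g x := by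
  set κ := (volume : Measure (En n)).restrict E with hκ
  have hfin : IsFiniteMeasure κ := ⟨by simpa [hκ] using hEf⟩
  let K : Set (Lp ℝ 2 κ) := {a | Y (ext0 E a) ≤ T'}
  have hext : ∀ a b : En n → ℝ, a =ᵐ[κ] b → Y (ext0 E a) = Y (ext0 E b) := by
    intro a b hab
    refine hY.congr ?_
    have := (ae_restrict_iff' hE).1 hab
    filter_upwards [this] with x hx
    unfold ext0
    by_cases hxE : x ∈ E
    · simp [hxE, hx hxE]
    · simp [hxE]
  have hconv : Convex ℝ K := by
    intro a ha b hb s t hs ht hst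
    have ha : Y (ext0 E a) ≤ T' := ha
    have hb : Y (ext0 E b) ≤ T' := hb
    change Y (ext0 E (s • a + t • b : Lp ℝ 2 κ)) ≤ T'
    have h1 : ((s • a + t • b : Lp ℝ 2 κ) : En n → ℝ) =ᵐ[κ] fun x => s * a x + t * b x := by
      filter_upwards [Lp.coeFn_add (s • a) (t • b), Lp.coeFn_smul s a, Lp.coeFn_smul t b]
        with x h1 h2 h3
      rw [h1, Pi.add_apply, h2, h3]; rfl
    rw [hext _ _ h1]
    have h2 : Y (ext0 E fun x => s * a x + t * b x) ≤
        Y ((fun x => (s.toNNReal : ℝ≥0∞) * ext0 E a x) +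
          (fun x => (t.toNNReal : ℝ≥0∞) * ext0 E b x)) := by
      refine hY.mono _ _ (ae_of_all _ fun x => ?_)
      unfold ext0
      by_cases hxE : x ∈ E
      · simp only [hxE, indicator_of_mem, Pi.add_apply]
        refine ENNReal.ofReal_add_le.trans ?_
        rw [ENNReal.ofReal_mul hs, ENNReal.ofReal_mul ht]
        rfl
      · simp [hxE]
    refine h2.trans ((hY.tri _ _).trans ?_)
    rw [hY.smul, hY.smul]
    calc _ ≤ (s.toNNReal : ℝ≥0∞) * T' + (t.toNNReal : ℝ≥0∞) * T' := by gcongr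
      _ = ((s.toNNReal + t.toNNReal : ℝ≥0) : ℝ≥0∞) * T' := by push_cast; ring
      _ = T' := by
          rw [← Real.toNNReal_add hs ht, hst]; simp
  have hclosed : IsClosed K := by
    refine IsSeqClosed.isClosed ?_
    intro a b ha hab
    obtain ⟨ns, -, hns⟩ := (tendstoInMeasure_of_tendsto_Lp hab).exists_seq_tendsto_ae
    change Y (ext0 E b) ≤ T'
    refine hY.fatou (f := fun i => ext0 E (a (ns i))) ?_ (fun i => ha (ns i))
    have := (ae_restrict_iff' hE).1 hns
    filter_upwards [this] with x hx
    unfold ext0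
    by_cases hxE : x ∈ E
    · simp only [hxE, indicator_of_mem]
      exact (ENNReal.continuous_ofReal.tendsto _).comp (hx hxE)
    · simp [hxE]
  have h1mem : MemLp (fun _ : En n => (1 : ℝ)) 2 κ := memLp_const 1
  have hnot : h1mem.toLp _ ∉ K := by
    intro hmem
    have hmem : Y (ext0 E (h1mem.toLp _)) ≤ T' := hmem
    rw [hext _ _ h1mem.coeFn_toLp] at hmem
    have : ext0 E (fun _ => 1) = E.indicator 1 := by
      ext x; simp [ext0, indicator]
    rw [this] at hmem
    exact absurd hlt (not_lt.2 hmem)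
  obtain ⟨φ, u, hu1, hu2⟩ := geometric_hahn_banach_closed_point hconv hclosed hnot
  set g : Lp ℝ 2 κ := (InnerProductSpace.toDual ℝ _).symm φ with hg
  have hφ : ∀ (a : En n → ℝ) (ha : MemLp a 2 κ), Integrable (fun x => a x * g x) κ ∧
      φ (ha.toLp a) = ∫ x, a x * g x ∂κ := by
    intro a ha
    have h2 := L2.integrable_inner (𝕜 := ℝ) g (ha.toLp a)
    have h3 : (fun x => inner ℝ (g x) (ha.toLp a x)) =ᵐ[κ] fun x => a x * g x := by
      filter_upwards [ha.coeFn_toLp] with x hx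
      rw [hx]; simp
    refine ⟨h2.congr h3, ?_⟩
    rw [← InnerProductSpace.toDual_symm_apply, ← hg, L2.inner_def]
    exact integral_congr_ae h3
  refine ⟨g, u, (Lp.stronglyMeasurable g).measurable, ?_, ?_, ?_, ?_⟩
  · have h0 : (0 : Lp ℝ 2 κ) ∈ K := by
      change Y (ext0 E (0 : Lp ℝ 2 κ)) ≤ T'
      rw [hext _ _ (Lp.coeFn_zero ℝ 2 κ)]
      have : ext0 E (0 : En n → ℝ) = fun x => ((0 : ℝ≥0) : ℝ≥0∞) * (0 : ℝ≥0∞) := by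
        ext x; simp [ext0, indicator]
      rw [this, hY.smul 0 (fun _ => 0)]
      simp
    simpa using hu1 0 h0
  · rintro a ha ⟨c, hc⟩ haY
    have hmem : MemLp a 2 κ := MemLp.of_bound ha.aestronglyMeasurable c (ae_of_all _ hc)
    obtain ⟨hi, he⟩ := hφ a hmem
    refine ⟨hi, ?_⟩
    rw [← he]
    refine hu1 _ ?_
    change Y (ext0 E (hmem.toLp a)) ≤ T'
    rw [hext _ _ hmem.coeFn_toLp]
    exact haY
  · simpa using (hφ _ h1mem).1
  · have := (hφ _ h1mem).2
    rw [this] at hu2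
    simpa using hu2

lemma exists_measurable_factor (φ : En n → ℝ≥0∞) {g : En n → ℝ≥0∞} (hg : Measurable g)
    (hgt : ∀ x, g x ≠ ⊤) : ∃ φ' : En n → ℝ≥0∞, Measurable φ' ∧ (∀ x, φ' x ≤ φ x) ∧
      ∫⁻ x, φ x * g x = ∫⁻ x, φ' x * g x := by
  obtain ⟨h, hm, hle, heq⟩ := exists_measurable_le_lintegral_eq volume (fun x => φ x * g x)
  refine ⟨fun x => h x / g x, hm.div hg, fun x => ENNReal.div_le_of_le_mul (hle x), ?_⟩
  rw [heq]
  refine lintegral_congr fun x => ?_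
  rcases eq_or_ne (g x) 0 with h0 | h0
  · have := hle x
    simp only [h0, mul_zero, nonpos_iff_eq_zero] at this ⊢
    exact this
  · rw [ENNReal.div_mul_cancel h0 (hgt x)]

lemma luxemburg_fin {Y : (En n → ℝ≥0∞) → ℝ≥0∞} (hY : FNorm Y) {E : Set (En n)}
    (hE : MeasurableSet E) (hEf : volume E < ⊤) {T : ℝ≥0∞}
    (hT : ∀ g : En n → ℝ≥0∞, Measurable g → (∀ x, g x ≠ ⊤) → assocQ n Y g ≤ 1 →
      ∫⁻ x in E, g x ≤ T) :
    Y (E.indicator 1) ≤ T := by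
  by_contra hcon
  rw [not_le] at hcon
  obtain ⟨T', hT1, hT2⟩ := ENNReal.lt_iff_exists_nnreal_btwn.1 hcon
  obtain ⟨g, u, hgm, hu, hK, hgi, hug⟩ := separation hY hE hEf hT2
  have hT'0 : 0 < T' := by
    have := (zero_le (a := T)).trans_lt hT1
    exact_mod_cast this
  set U : ℝ≥0 := u.toNNReal with hU
  have hU0 : 0 < U := Real.toNNReal_pos.2 hu
  set g0 : En n → ℝ≥0∞ := ext0 E g with hg0
  have hg0m : Measurable g0 := hgm.ennreal_ofReal.indicator hE
  have hg0t : ∀ x, g0 x ≠ ⊤ := by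
    intro x
    rw [hg0, ext0]
    by_cases hx : x ∈ E <;> simp [hx]
  have hbig : (U : ℝ≥0∞) < ∫⁻ x in E, g0 x := by
    have h1 : ∫⁻ x in E, g0 x = ∫⁻ x in E, ENNReal.ofReal (g x) := by
      refine setLIntegral_congr_fun hE fun x hx => ?_
      simp [hg0, ext0, hx]
    have h2 : ENNReal.ofReal (∫ x in E, max (g x) 0) = ∫⁻ x in E, ENNReal.ofReal (g x) := by
      rw [ofReal_integral_eq_lintegral_ofReal hgi.pos_part (ae_of_all _ fun x => le_max_right _ _)]
      refine lintegral_congr fun x => ?_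
      rcases le_total (g x) 0 with h | h
      · simp [h]
      · simp [h]
    rw [h1, ← h2]
    have h3 : ∫ x in E, g x ≤ ∫ x in E, max (g x) 0 :=
      integral_mono hgi hgi.pos_part fun x => le_max_left _ _
    exact (ENNReal.ofReal_lt_ofReal_iff (hu.trans (hug.trans_le h3))).2 (hug.trans_le h3)
  have hass : ∀ φ : En n → ℝ≥0∞, Y φ ≤ 1 → (T' : ℝ≥0∞) * ∫⁻ x, φ x * g0 x ≤ U := by
    intro φ hφ
    obtain ⟨φ', hφm, hφle, hφeq⟩ := exists_measurable_factor φ hg0m hg0t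
    rw [hφeq]
    have hφ' : Y φ' ≤ 1 := (hY.mono _ _ (ae_of_all _ hφle)).trans hφ
    have hsup : ∫⁻ x, φ' x * g0 x = ⨆ k : ℕ, ∫⁻ x, min (φ' x) k * g0 x := by
      rw [← lintegral_iSup]
      · refine lintegral_congr fun x => ?_
        rw [← ENNReal.iSup_mul]
        congr 1
        rw [← inf_iSup_eq, ENNReal.iSup_natCast, inf_top_eq]
      · intro k
        exact (hφm.min measurable_const).mul hg0m
      · intro k k' hk x
        simp only
        gcongr
    rw [hsup, ENNReal.mul_iSup]
    refine iSup_le fun k => ?_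
    set P := {x | 0 < g x} with hP
    have hPm : MeasurableSet P := measurableSet_lt measurable_const hgm
    set a : En n → ℝ := P.indicator (fun x => (T' : ℝ) * (min (φ' x) k).toReal) with ha
    have hmt : ∀ x, min (φ' x) (k : ℝ≥0∞) ≠ ⊤ := fun x =>
      ne_top_of_le_ne_top (ENNReal.natCast_ne_top k) (min_le_right _ _)
    have ham : Measurable a :=
      ((hφm.min measurable_const).ennreal_toReal.const_mul _).indicator hPm
    have hann : ∀ x, 0 ≤ a x := by
      intro x
      exact indicator_nonneg (fun _ _ => by positivity) x
    have hof : ∀ x, ENNReal.ofReal (a x) = P.indicator (fun x => T' * min (φ' x) k) x := by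
      intro x
      by_cases hx : x ∈ P
      · simp only [ha, hx, indicator_of_mem]
        rw [ENNReal.ofReal_mul (by positivity), ENNReal.ofReal_toReal (hmt x)]
        simp
      · simp [ha, hx]
    obtain ⟨hi, hlt⟩ := hK a ham ⟨T' * k, fun x => by
        rw [Real.norm_of_nonneg (hann x)]
        by_cases hx : x ∈ P
        · simp only [ha, hx, indicator_of_mem]
          gcongr
          have := ENNReal.toReal_mono (ENNReal.natCast_ne_top k) (min_le_right (φ' x) (k : ℝ≥0∞))
          simpa using this
        · simp only [ha, hx, indicator_of_notMem, not_false_eq_true]; positivity⟩ (by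
        calc Y (ext0 E a) ≤ Y (fun x => (T' : ℝ≥0∞) * φ' x) := by
              refine hY.mono _ _ (ae_of_all _ fun x => ?_)
              by_cases hx : x ∈ E
              · simp only [ext0, hx, indicator_of_mem]
                rw [hof]
                refine indicator_le_self' (fun _ _ => zero_le) x |>.trans ?_
                gcongr
                exact min_le_left _ _
              · simp [ext0, hx]
          _ = T' * Y φ' := hY.smul _ _
          _ ≤ T' * 1 := by gcongr
          _ = T' := mul_one _)
    have hnn : ∀ x, 0 ≤ a x * g x := by
      intro x
      by_cases hx : x ∈ P
      · exact mul_nonneg (hann x) (le_of_lt hx)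
      · simp [ha, hx]
    have h5 : (T' : ℝ≥0∞) * ∫⁻ x, min (φ' x) k * g0 x = ENNReal.ofReal (∫ x in E, a x * g x) := by
      rw [ofReal_integral_eq_lintegral_ofReal hi (ae_of_all _ hnn),
        ← lintegral_const_mul' _ _ ENNReal.coe_ne_top, ← lintegral_indicator hE]
      refine lintegral_congr fun x => ?_
      by_cases hx : x ∈ E
      · simp only [hx, indicator_of_mem, hg0, ext0]
        rw [ENNReal.ofReal_mul (hann x), hof]
        by_cases hxP : x ∈ P
        · simp only [hxP, indicator_of_mem]; ring
        · have : g x ≤ 0 := not_lt.1 hxP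
          simp [ENNReal.ofReal_of_nonpos this]
      · simp [hx, hg0, ext0]
    rw [h5]
    exact ENNReal.ofReal_le_ofReal hlt.le
  have hU' : (U : ℝ≥0∞) ≠ 0 := by exact_mod_cast hU0.ne'
  set c : ℝ≥0 := T' / U with hc
  have h6 := hT (fun x => c * g0 x) (hg0m.const_mul _)
    (fun x => ENNReal.mul_ne_top ENNReal.coe_ne_top (hg0t x)) (by
      unfold assocQ
      refine iSup₂_le fun φ hφ => ?_
      have : ∀ x, φ x * (c * g0 x) = c * (φ x * g0 x) := fun x => by ring
      simp_rw [this]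
      rw [lintegral_const_mul' _ _ ENNReal.coe_ne_top, hc, ENNReal.coe_div hU0.ne',
        div_eq_mul_inv, mul_right_comm, ← div_eq_mul_inv]
      exact ENNReal.div_le_of_le_mul (by rw [one_mul]; exact hass φ hφ))
  rw [lintegral_const_mul' _ _ ENNReal.coe_ne_top] at h6
  have hc0 : 0 < c := by positivity
  have h7 : (T' : ℝ≥0∞) = c * U := by
    rw [hc, ← ENNReal.coe_mul, div_mul_cancel₀ _ hU0.ne']
  have h8 : (c : ℝ≥0∞) * U ≤ c * ∫⁻ x in E, g0 x := by gcongr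
  exact absurd (hT1.trans_le (h7.le.trans (h8.trans h6))) (lt_irrefl _)

lemma luxemburg {Y : (En n → ℝ≥0∞) → ℝ≥0∞} (hY : FNorm Y) {E : Set (En n)}
    (hE : MeasurableSet E) {T : ℝ≥0∞}
    (hT : ∀ g : En n → ℝ≥0∞, Measurable g → (∀ x, g x ≠ ⊤) → assocQ n Y g ≤ 1 →
      ∫⁻ x in E, g x ≤ T) :
    Y (E.indicator 1) ≤ T := by
  have h1 : (E.indicator 1 : En n → ℝ≥0∞) =
      fun x => ⨆ m : ℕ, (E ∩ ball 0 (m : ℝ)).indicator (1 : En n → ℝ≥0∞) x := by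
    ext x
    by_cases hx : x ∈ E
    · obtain ⟨m, hm⟩ := exists_nat_gt (dist x 0)
      refine le_antisymm ?_ (iSup_le fun m => ?_)
      · refine le_iSup_of_le m ?_
        simp only [indicator, mem_inter_iff, hx, mem_ball, hm, and_self, if_true, le_refl]
      · exact indicator_le_indicator_of_subset inter_subset_left (fun _ => zero_le) x
    · simp [indicator, hx]
  rw [h1, hY.sup (fun m : ℕ => (E ∩ ball 0 (m : ℝ)).indicator (1 : En n → ℝ≥0∞))]
  · refine iSup_le fun m => ?_
    refine luxemburg_fin hY (hE.inter measurableSet_ball)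
      ((measure_mono inter_subset_right).trans_lt measure_ball_lt_top) fun g hg hgt hass => ?_
    exact (lintegral_mono_set inter_subset_left).trans (hT g hg hgt hass)
  · intro m m' hm x
    exact indicator_le_indicator_of_subset
      (inter_subset_inter_right _ (ball_subset_ball (by exact_mod_cast hm))) (fun _ => zero_le) x

end FS

namespace FS

open Metric Filter Topology

variable {n : ℕ}

lemma volume_ball_two (x c : En n) {ρ : ℝ} (hρ : 0 < ρ) :
    volume (ball x (2 * ρ)) = ((2 ^ n : ℝ≥0) : ℝ≥0∞) * volume (ball c ρ) := by
  rw [Measure.addHaar_ball_mul_of_pos _ _ two_pos, Measure.addHaar_ball_center volume c]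
  congr 1
  rw [finrank_euclideanSpace_fin, ENNReal.ofReal_pow (by norm_num)]
  simp

lemma dbl_volume : Dbl (volume : Measure (En n)) (2 ^ n) :=
  ⟨fun c _ hρ => measure_ball_pos _ c hρ, fun _ _ => measure_ball_lt_top,
    fun c _ hρ => (volume_ball_two c c hρ).le⟩

lemma hlMax_le_uMax (f : En n → ℝ≥0∞) (x : En n) : hlMax n f x ≤ uMax volume f x := by
  unfold hlMax
  exact iSup₂_le fun ρ hρ => le_uMax f (mem_ball_self hρ)

lemma uMax_le_hlMax (f : En n → ℝ≥0∞) (x : En n) :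
    uMax volume f x ≤ ((2 ^ n : ℝ≥0) : ℝ≥0∞) * hlMax n f x := by
  refine uMax_le fun c ρ hx => ?_
  have hρ := pos_of_mem_ball hx
  have hsub : ball c ρ ⊆ ball x (2 * ρ) := by
    refine ball_subset_ball' ?_
    rw [mem_ball, dist_comm] at hx
    linarith
  have hv := volume_ball_two x c hρ
  have h0 : ((2 ^ n : ℝ≥0) : ℝ≥0∞) ≠ 0 := by simp
  have h1 : (volume (ball c ρ))⁻¹ = ((2 ^ n : ℝ≥0) : ℝ≥0∞) * (volume (ball x (2 * ρ)))⁻¹ := by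
    rw [hv, ENNReal.mul_inv (Or.inl h0) (Or.inl ENNReal.coe_ne_top), ← mul_assoc,
      ENNReal.mul_inv_cancel h0 ENNReal.coe_ne_top, one_mul]
  rw [h1, mul_assoc]
  gcongr
  calc _ ≤ (volume (ball x (2 * ρ)))⁻¹ * ∫⁻ y in ball x (2 * ρ), f y := by gcongr
    _ ≤ _ := by
      unfold hlMax
      exact le_iSup₂_of_le (2 * ρ) (by linarith) le_rfl

/-- The associate norm, testing only measurable functions. -/
def assocM (Y : (En n → ℝ≥0∞) → ℝ≥0∞) (g : En n → ℝ≥0∞) : ℝ≥0∞ :=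
  ⨆ (f : En n → ℝ≥0∞) (_ : Measurable f ∧ Y f ≤ 1), ∫⁻ x, f x * g x

lemma assocM_le (Y : (En n → ℝ≥0∞) → ℝ≥0∞) (g : En n → ℝ≥0∞) : assocM Y g ≤ assocQ n Y g :=
  iSup₂_le fun f hf => le_iSup₂_of_le (f := fun (f : En n → ℝ≥0∞) (_ : Y f ≤ 1) =>
    ∫⁻ x, f x * g x) f hf.2 le_rfl

lemma le_assocM {Y : (En n → ℝ≥0∞) → ℝ≥0∞} {f g : En n → ℝ≥0∞} (hf : Measurable f)
    (hY : Y f ≤ 1) : ∫⁻ x, f x * g x ≤ assocM Y g :=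
  le_iSup₂_of_le (f := fun (f : En n → ℝ≥0∞) (_ : Measurable f ∧ Y f ≤ 1) =>
    ∫⁻ x, f x * g x) f ⟨hf, hY⟩ le_rfl

lemma holderM {Y : (En n → ℝ≥0∞) → ℝ≥0∞} (hY : FNorm Y) {φ w : En n → ℝ≥0∞} (hφ : Measurable φ)
    (hw : assocM Y w ≤ 2) : ∫⁻ x, φ x * w x ≤ 2 * Y φ := by
  by_contra hcon
  rw [not_le] at hcon
  have h1 : Y φ < (∫⁻ x, φ x * w x) / 2 := by
    rw [ENNReal.lt_div_iff_mul_lt (by simp) (by simp), mul_comm]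
    exact hcon
  obtain ⟨t, ht1, ht2⟩ := ENNReal.lt_iff_exists_nnreal_btwn.1 h1
  have ht0 : 0 < t := by
    have := (zero_le (a := Y φ)).trans_lt ht1
    exact_mod_cast this
  have ht0' : (t : ℝ≥0∞) ≠ 0 := by exact_mod_cast ht0.ne'
  have h2 : Y (fun x => ((t⁻¹ : ℝ≥0) : ℝ≥0∞) * φ x) ≤ 1 := by
    rw [hY.smul, ENNReal.coe_inv ht0.ne']
    calc (t : ℝ≥0∞)⁻¹ * Y φ ≤ (t : ℝ≥0∞)⁻¹ * t := by gcongr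
      _ = 1 := ENNReal.inv_mul_cancel ht0' ENNReal.coe_ne_top
  have h3 := (le_assocM (g := w) (hφ.const_mul _) h2).trans hw
  simp_rw [mul_assoc] at h3
  rw [lintegral_const_mul' _ _ ENNReal.coe_ne_top] at h3
  have h4 : ∫⁻ x, φ x * w x ≤ t * 2 := by
    calc ∫⁻ x, φ x * w x = t * (((t⁻¹ : ℝ≥0) : ℝ≥0∞) * ∫⁻ x, φ x * w x) := by
          rw [← mul_assoc, ENNReal.coe_inv ht0.ne',
            ENNReal.mul_inv_cancel ht0' ENNReal.coe_ne_top, one_mul]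
      _ ≤ t * 2 := by gcongr
  rw [ENNReal.lt_div_iff_mul_lt (by simp) (by simp)] at ht2
  exact absurd h4 (not_le.2 ht2)

lemma assocQ_le_assocM {Y : (En n → ℝ≥0∞) → ℝ≥0∞} (hY : FNorm Y)
    (hfin : ∀ E : Set (En n), MeasurableSet E → volume E < ⊤ → Y (E.indicator 1) < ⊤)
    {g : En n → ℝ≥0∞} (hg : Measurable g) : assocQ n Y g ≤ assocM Y g := by
  have hSm : MeasurableSet {x | g x = ⊤} := hg (measurableSet_singleton ⊤)
  rcases eq_or_ne (volume {x | g x = ⊤}) 0 with h0 | h0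
  · refine iSup₂_le fun φ hφ => ?_
    set g' : En n → ℝ≥0∞ := {x | g x = ⊤}ᶜ.indicator g with hg'
    have hg'm : Measurable g' := hg.indicator hSm.compl
    have hgg : ∀ᵐ x, g x = g' x := by
      have : ∀ᵐ x, ¬ (g x = ⊤) := by
        rw [ae_iff]; simpa using h0
      filter_upwards [this] with x hx
      simp [hg', indicator, hx]
    have hg't : ∀ x, g' x ≠ ⊤ := by
      intro x
      by_cases hx : g x = ⊤ <;> simp [hg', indicator, hx]
    obtain ⟨φ', hm, hle, heq⟩ := exists_measurable_factor φ hg'm hg't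
    have e1 : ∀ ψ : En n → ℝ≥0∞, ∫⁻ x, ψ x * g x = ∫⁻ x, ψ x * g' x := fun ψ =>
      lintegral_congr_ae (hgg.mono fun x hx => by simp only [hx])
    rw [e1, heq, ← e1]
    exact le_assocM hm ((hY.mono _ _ (ae_of_all _ hle)).trans hφ)
  · have hex : ∃ m : ℕ, volume ({x | g x = ⊤} ∩ ball 0 (m : ℝ)) ≠ 0 := by
      by_contra hcon
      push Not at hcon
      apply h0
      have : {x | g x = ⊤} = ⋃ m : ℕ, {x | g x = ⊤} ∩ ball 0 (m : ℝ) := by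
        rw [← inter_iUnion, iUnion_ball_nat, inter_univ]
      rw [this]
      exact measure_iUnion_null hcon
    obtain ⟨m, hm⟩ := hex
    set S := {x | g x = ⊤} ∩ ball (0 : En n) (m : ℝ) with hS
    have hSmm : MeasurableSet S := hSm.inter measurableSet_ball
    have hYS := hfin S hSmm ((measure_mono inter_subset_right).trans_lt measure_ball_lt_top)
    obtain ⟨t, ht⟩ : ∃ t : ℝ≥0, (t : ℝ≥0∞) = Y (S.indicator 1) :=
      ⟨_, ENNReal.coe_toNNReal hYS.ne⟩
    set c : ℝ≥0 := (t + 1)⁻¹ with hc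
    have hc0 : 0 < c := by positivity
    have h1 : Y (fun x => (c : ℝ≥0∞) * S.indicator 1 x) ≤ 1 := by
      rw [hY.smul, ← ht, ← ENNReal.coe_mul]
      have : c * t ≤ 1 := by
        calc c * t ≤ c * (t + 1) := by gcongr; exact le_self_add
          _ = 1 := inv_mul_cancel₀ (by positivity)
      exact_mod_cast this
    have h2 := le_assocM (g := g) ((measurable_one.indicator hSmm).const_mul (c : ℝ≥0∞)) h1
    have h3 : ∫⁻ x, (c : ℝ≥0∞) * S.indicator 1 x * g x = ⊤ := by
      rw [eq_top_iff]
      calc ⊤ = ∫⁻ x in S, ⊤ := by rw [setLIntegral_const, ENNReal.top_mul hm]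
        _ = ∫⁻ x, S.indicator (fun _ => ⊤) x := by rw [lintegral_indicator hSmm]
        _ ≤ _ := by
            refine lintegral_mono fun x => ?_
            by_cases hx : x ∈ S
            · have hgx : g x = ⊤ := hx.1
              simp [hx, hgx, hc0.ne']
            · simp [hx]
    rw [h3] at h2
    exact le_top.trans h2

lemma assocM_tsum (Y : (En n → ℝ≥0∞) → ℝ≥0∞) {g : ℕ → En n → ℝ≥0∞}
    (hg : ∀ k, Measurable (g k)) : assocM Y (fun x => ∑' k, g k x) ≤ ∑' k, assocM Y (g k) := by
  refine iSup₂_le fun φ hφ => ?_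
  simp_rw [← ENNReal.tsum_mul_left]
  rw [lintegral_tsum (f := fun k x => φ x * g k x) fun k => (hφ.1.mul (hg k)).aemeasurable]
  exact ENNReal.tsum_le_tsum fun k => le_assocM hφ.1 hφ.2

lemma assocM_smul (Y : (En n → ℝ≥0∞) → ℝ≥0∞) (c : ℝ≥0) (g : En n → ℝ≥0∞) :
    assocM Y (fun x => c * g x) ≤ c * assocM Y g := by
  refine iSup₂_le fun φ hφ => ?_
  have : ∀ x, φ x * (c * g x) = c * (φ x * g x) := fun x => by ring
  simp_rw [this]
  rw [lintegral_const_mul' _ _ ENNReal.coe_ne_top]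
  gcongr
  exact le_assocM hφ.1 hφ.2

lemma assocQ_smul (Y : (En n → ℝ≥0∞) → ℝ≥0∞) (c : ℝ≥0) (g : En n → ℝ≥0∞) :
    assocQ n Y (fun x => c * g x) ≤ c * assocQ n Y g := by
  refine iSup₂_le fun φ hφ => ?_
  have : ∀ x, φ x * (c * g x) = c * (φ x * g x) := fun x => by ring
  simp_rw [this]
  rw [lintegral_const_mul' _ _ ENNReal.coe_ne_top]
  gcongr
  exact le_iSup₂_of_le (f := fun (f : En n → ℝ≥0∞) (_ : Y f ≤ 1) =>
    ∫⁻ x, f x * g x) φ hφ le_rfl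

lemma assocQ_mono (Y : (En n → ℝ≥0∞) → ℝ≥0∞) {g h : En n → ℝ≥0∞} (hgh : ∀ x, g x ≤ h x) :
    assocQ n Y g ≤ assocQ n Y h := by
  unfold assocQ
  gcongr with φ hφ x
  exact hgh x

lemma fnorm_convQ (X : BallQBF n) {θ : ℝ} (hθ : 0 < θ)
    (htri : ∀ f g : En n → ℝ≥0∞, convQ n X.Q θ (f + g) ≤ convQ n X.Q θ f + convQ n X.Q θ g) :
    FNorm (convQ n X.Q θ) := by
  have hθ' : 0 < 1 / θ := by positivity
  refine ⟨fun f g h => ?_, fun c f => ?_, htri, fun f hf => ?_⟩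
  · unfold convQ
    refine ENNReal.rpow_le_rpow (X.mono _ _ ?_) hθ'.le
    filter_upwards [h] with x hx
    exact ENNReal.rpow_le_rpow hx hθ.le
  · unfold convQ
    have h1 : (fun x => ((c : ℝ≥0∞) * f x) ^ θ) = fun x => ((c ^ θ : ℝ≥0) : ℝ≥0∞) * f x ^ θ := by
      ext x
      rw [ENNReal.mul_rpow_of_nonneg _ _ hθ.le, ENNReal.coe_rpow_of_nonneg _ hθ.le]
    rw [h1, X.smul_eq, ENNReal.mul_rpow_of_nonneg _ _ hθ'.le, ENNReal.coe_rpow_of_nonneg _ hθ.le,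
      ← ENNReal.rpow_mul, mul_one_div_cancel hθ.ne', ENNReal.rpow_one]
  · unfold convQ
    have h1 : (fun x => (⨆ m, f m x) ^ θ) = fun x => ⨆ m, (f m x) ^ θ := by
      ext x
      exact (ENNReal.orderIsoRpow θ hθ).map_iSup _
    rw [h1, X.sup_of_monotone (fun m x => f m x ^ θ)]
    · exact (ENNReal.orderIsoRpow (1 / θ) hθ').map_iSup _
    · intro m m' hm x
      exact ENNReal.rpow_le_rpow (hf hm x) hθ.le

lemma convQ_eq (Q : (En n → ℝ≥0∞) → ℝ≥0∞) {s q : ℝ} (hs : 0 < s) (hq : 0 < q)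
    (f : En n → ℝ≥0∞) :
    convQ n Q (1 / s) f = (convQ n Q (1 / (s * q)) (fun x => f x ^ q)) ^ (1 / q) := by
  unfold convQ
  simp_rw [← ENNReal.rpow_mul]
  have e1 : q * (1 / (s * q)) = 1 / s := by field_simp
  have e2 : 1 / (1 / (s * q)) * (1 / q) = 1 / (1 / s) := by field_simp
  rw [e1, e2]

lemma main_est {Y : (En n → ℝ≥0∞) → ℝ≥0∞} (hY : FNorm Y)
    (hfin : ∀ E : Set (En n), MeasurableSet E → volume E < ⊤ → Y (E.indicator 1) < ⊤)
    (hM : ∃ C' : ℝ≥0, ∀ f : En n → ℝ≥0∞,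
      assocQ n Y (hlMax n f) ≤ (C' : ℝ≥0∞) * assocQ n Y f)
    {r q : ℝ} (hr : 1 < r) (hq : 1 ≤ q) :
    ∃ K : ℝ≥0, ∀ f : ℕ → En n → ℝ≥0∞, (∀ j, Measurable (f j)) → ∀ a : ℝ≥0, 0 < a →
      (a : ℝ≥0∞) ^ q * Y ({x | (a : ℝ≥0∞) < lr r (fun j => uMax volume (f j) x)}.indicator 1) ≤
        K * Y (fun x => lr r (fun j => f j x) ^ q) := by
  obtain ⟨C', hC'⟩ := hM
  have hq0 : 0 < q := by linarith
  set C1 : ℝ≥0 := 2 ^ n * C' + 1 with hC1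
  have hC10 : 0 < C1 := by positivity
  set A : ℝ≥0 := 2 * C1 with hA
  have hA0 : 0 < A := by positivity
  obtain ⟨Cw, hCw⟩ := weak_vv (n := n) (A * 2 ^ n) r q hr hq
  refine ⟨A ^ q * Cw * 2, fun f hf a ha => ?_⟩
  have hMM : ∀ g : En n → ℝ≥0∞, Measurable g → assocM Y (uMax volume g) ≤ C1 * assocM Y g := by
    intro g hg
    calc assocM Y (uMax volume g) ≤ assocQ n Y (uMax volume g) := assocM_le _ _
      _ ≤ assocQ n Y (fun x => ((2 ^ n : ℝ≥0) : ℝ≥0∞) * hlMax n g x) :=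
          assocQ_mono _ (uMax_le_hlMax g)
      _ ≤ ((2 ^ n : ℝ≥0) : ℝ≥0∞) * assocQ n Y (hlMax n g) := assocQ_smul _ _ _
      _ ≤ ((2 ^ n : ℝ≥0) : ℝ≥0∞) * (C' * assocQ n Y g) := by gcongr; exact hC' g
      _ = ((2 ^ n * C' : ℝ≥0) : ℝ≥0∞) * assocQ n Y g := by push_cast; ring
      _ ≤ C1 * assocM Y g := by
          gcongr
          · exact le_self_add
          · exact assocQ_le_assocM hY hfin hg
  set E := {x | (a : ℝ≥0∞) < lr r (fun j => uMax volume (f j) x)} with hE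
  have hEm : MeasurableSet E :=
    measurableSet_lt measurable_const (measurable_lr r fun j => measurable_uMax (f j))
  set F : En n → ℝ≥0∞ := fun x => lr r (fun j => f j x) with hF
  have hFm : Measurable F := measurable_lr r hf
  have ha0 : (a : ℝ≥0∞) ^ q ≠ 0 := by simp [ENNReal.rpow_eq_zero_iff, ha.ne', hq0.le]
  have hat : (a : ℝ≥0∞) ^ q ≠ ⊤ := ENNReal.rpow_ne_top_of_nonneg hq0.le ENNReal.coe_ne_top
  set T : ℝ≥0∞ := ((A ^ q * Cw * 2 : ℝ≥0) : ℝ≥0∞) * Y (fun x => F x ^ q) with hT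
  have hlux : Y (E.indicator 1) ≤ T / (a : ℝ≥0∞) ^ q := by
    refine luxemburg hY hEm fun g hg _ hass => ?_
    by_cases hg0 : g =ᵐ[volume] 0
    · rw [setLIntegral_congr_fun_ae hEm (g := fun _ => 0) (hg0.mono fun x hx _ => hx)]
      simp
    obtain ⟨w, hwm, hwpos, hgw, hwA, hNw⟩ := rubio dbl_volume (assocM Y) C1 hC10
      (fun g hg => assocM_tsum Y hg) (fun c g _ => assocM_smul Y c g) hMM hg hg0
    have hw2 : assocM Y w ≤ 2 := by
      refine hNw.trans ?_
      calc 2 * assocM Y g ≤ 2 * 1 := by gcongr; exact (assocM_le Y g).trans hass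
        _ = 2 := mul_one _
    have hwfin : ∀ c ρ, ∫⁻ x in ball c ρ, w x < ⊤ := by
      intro c ρ
      have h1 := holderM hY (measurable_one.indicator (measurableSet_ball (x := c) (ε := ρ))) hw2
      have h2 : ∫⁻ x in ball c ρ, w x =
          ∫⁻ x, (ball c ρ).indicator (1 : En n → ℝ≥0∞) x * w x := by
        rw [← lintegral_indicator measurableSet_ball]
        refine lintegral_congr fun x => ?_
        by_cases hx : x ∈ ball c ρ <;> simp only [indicator, hx, if_true, if_false] <;> simp
      rw [h2]
      exact h1.trans_lt (ENNReal.mul_lt_top (by norm_num)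
        (hfin _ measurableSet_ball measure_ball_lt_top))
    have h3 := weighted_step hr hq hA0 hCw dbl_volume hwm hwpos hwfin hwA hf ha
    rw [ENNReal.le_div_iff_mul_le (Or.inl ha0) (Or.inl hat), mul_comm]
    calc (a : ℝ≥0∞) ^ q * ∫⁻ x in E, g x ≤ (a : ℝ≥0∞) ^ q * ∫⁻ x in E, w x := by
          gcongr with x; exact hgw x
      _ ≤ ((A ^ q * Cw : ℝ≥0) : ℝ≥0∞) * ∫⁻ x, F x ^ q * w x := h3
      _ ≤ ((A ^ q * Cw : ℝ≥0) : ℝ≥0∞) * (2 * Y (fun x => F x ^ q)) := by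
          gcongr; exact holderM hY (hFm.pow_const q) hw2
      _ = T := by rw [hT]; push_cast; ring
  rwa [ENNReal.le_div_iff_mul_le (Or.inl ha0) (Or.inl hat), mul_comm] at hlux

end FS

/-- **Weak-type Fefferman–Stein vector-valued maximal inequality on `X^{1/s}`**
(Proposition: it holds for all ball quasi-Banach function spaces under extrapolation
assumptions). -/
theorem weakType_FeffermanStein {n : ℕ} (hn : 1 ≤ n) (r s q₀ : ℝ)
    (hr : 1 < r) (hs : 0 < s) (hq₀ : 1 ≤ q₀)
    (X : BallQBF n)
    -- `X^{1/s}` is a ball Banach function space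
    (hconv : ∀ f g : En n → ℝ≥0∞,
      convQ n X.Q (1/s) (f + g) ≤ convQ n X.Q (1/s) f + convQ n X.Q (1/s) g)
    -- `X^{1/(s q₀)}` is a Banach function space:
    -- triangle inequality,
    (hBanach_tri : ∀ f g : En n → ℝ≥0∞,
      convQ n X.Q (1/(s*q₀)) (f + g) ≤ convQ n X.Q (1/(s*q₀)) f + convQ n X.Q (1/(s*q₀)) g)
    -- characteristic functions of finite-measure sets have finite norm,
    (hBanach_fin : ∀ E : Set (En n), MeasurableSet E → volume E < ⊤ →
      convQ n X.Q (1/(s*q₀)) (E.indicator 1) < ⊤)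
    -- and local embedding into `L¹`
    (hBanach_int : ∀ E : Set (En n), MeasurableSet E → volume E < ⊤ →
      ∃ C_E : ℝ≥0, ∀ f : En n → ℝ≥0∞,
        (∫⁻ x in E, f x) ≤ (C_E : ℝ≥0∞) * convQ n X.Q (1/(s*q₀)) f)
    -- the Hardy–Littlewood maximal operator is bounded on the associate space of `X^{1/(s q₀)}`
    (hM : ∃ C' : ℝ≥0, ∀ f : En n → ℝ≥0∞,
      assocQ n (convQ n X.Q (1/(s*q₀))) (hlMax n f) ≤
        (C' : ℝ≥0∞) * assocQ n (convQ n X.Q (1/(s*q₀))) f) :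
    ∃ C : ℝ≥0, 0 < C ∧ ∀ (f : ℕ → En n → ℝ≥0∞) (α : ℝ≥0), 0 < α →
      (α : ℝ≥0∞) * convQ n X.Q (1/s)
          ({x | (α : ℝ≥0∞) < (∑' j, (hlMax n (f j) x) ^ r) ^ (1/r)}.indicator 1) ≤
        (C : ℝ≥0∞) * convQ n X.Q (1/s) (fun x => (∑' j, (f j x) ^ r) ^ (1/r)) := by
  have hq0 : 0 < q₀ := by linarith
  have hr0 : 0 < r := by linarith
  have hθ : 0 < 1 / (s * q₀) := by positivity
  have hY := FS.fnorm_convQ X hθ hBanach_tri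
  obtain ⟨K, hK⟩ := FS.main_est hY hBanach_fin hM hr hq₀
  refine ⟨K ^ (1 / q₀) + 1, by positivity, fun f α hα => ?_⟩
  choose g hgm hgle hgeq using fun j => exists_measurable_le_forall_setLIntegral_eq volume (f j)
  have hmax : ∀ j x, hlMax n (f j) x = hlMax n (g j) x := by
    intro j x
    unfold hlMax
    simp_rw [hgeq j]
  have hKg := hK g hgm α hα
  set E := {x | (α : ℝ≥0∞) < FS.lr r (fun j => FS.uMax volume (g j) x)} with hE
  have hsub : {x | (α : ℝ≥0∞) < (∑' j, (hlMax n (f j) x) ^ r) ^ (1 / r)} ⊆ E := by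
    intro x hx
    simp only [mem_ofPred_eq] at hx
    refine lt_of_lt_of_le hx ?_
    change FS.lr r (fun j => hlMax n (f j) x) ≤ _
    refine FS.lr_mono hr0 fun j => ?_
    rw [hmax]
    exact FS.hlMax_le_uMax _ _
  rw [FS.convQ_eq X.Q hs hq0, FS.convQ_eq X.Q hs hq0 (fun x => (∑' j, (f j x) ^ r) ^ (1 / r))]
  have h1 : convQ n X.Q (1 / (s * q₀)) (fun x =>
      ({x | (α : ℝ≥0∞) < (∑' j, (hlMax n (f j) x) ^ r) ^ (1 / r)}.indicator 1 x) ^ q₀) ≤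
      convQ n X.Q (1 / (s * q₀)) (E.indicator 1) := by
    refine hY.mono _ _ (ae_of_all _ fun x => ?_)
    by_cases hx : x ∈ {x | (α : ℝ≥0∞) < (∑' j, (hlMax n (f j) x) ^ r) ^ (1 / r)}
    · rw [indicator_of_mem hx, indicator_of_mem (hsub hx)]
      simp
    · rw [indicator_of_notMem hx]
      simp [hq0]
  have h2 : convQ n X.Q (1 / (s * q₀)) (fun x => FS.lr r (fun j => g j x) ^ q₀) ≤
      convQ n X.Q (1 / (s * q₀)) (fun x => ((∑' j, (f j x) ^ r) ^ (1 / r)) ^ q₀) := by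
    refine hY.mono _ _ (ae_of_all _ fun x => ?_)
    refine ENNReal.rpow_le_rpow ?_ hq0.le
    change _ ≤ FS.lr r (fun j => f j x)
    exact FS.lr_mono hr0 fun j => hgle j x
  have h3 : (α : ℝ≥0∞) ^ q₀ * convQ n X.Q (1 / (s * q₀)) (fun x =>
      ({x | (α : ℝ≥0∞) < (∑' j, (hlMax n (f j) x) ^ r) ^ (1 / r)}.indicator 1 x) ^ q₀) ≤
      K * convQ n X.Q (1 / (s * q₀)) (fun x => ((∑' j, (f j x) ^ r) ^ (1 / r)) ^ q₀) :=
    (mul_le_mul_right h1 _).trans (hKg.trans (mul_le_mul_right h2 _))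
  have hq' : 0 ≤ 1 / q₀ := by positivity
  have h4 := ENNReal.rpow_le_rpow h3 hq'
  rw [ENNReal.mul_rpow_of_nonneg _ _ hq', ENNReal.mul_rpow_of_nonneg _ _ hq',
    ← ENNReal.rpow_mul, mul_one_div_cancel hq0.ne', ENNReal.rpow_one] at h4
  refine h4.trans ?_
  refine mul_le_mul_left ?_ _
  rw [← ENNReal.coe_rpow_of_nonneg _ hq']
  exact_mod_cast le_self_add
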